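/- arXiv:2407.18082 — 4 statements merged into one kernel-verified Lean document; each statement's English description precedes it below -/
import Mathlib

section
/- Let x₀ < x₁ < x₂ be real numbers, E₁ := (x₀, x₁), E₂ := (x₂, +∞), I₂ := (x₂, x₂ + 2), and for f measurable and integrable on every bounded measurable subset of E₁ ∪ E₂ set S(f) := |f|_{Ḣ^{1/2}(E₁)} + |f|_{Ḣ^{1/2}(E₂)} + | avg_{E₁} f − avg_{I₂} f |. Then there exists a constant C > 0, depending only on x₀, x₁, x₂, such that for every such f with S(f) < ∞: C⁻¹ S(f) ≤ inf{ |f̃|_{Ḣ^{1/2}(ℝ)} : f̃ measurable on ℝ, integrable on every bounded measurable subset of ℝ, f̃ = f a.e. on E₁ ∪ E₂ } ≤ C S(f). In other words, the space Ḣ^{1/2}(E₁ ∪ E₂) with the nonlocal seminorm S coincides, with equivalent seminorms, with the space of restrictions of Ḣ^{1/2}(ℝ) functions. -/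
open MeasureTheory Set Filter
open scoped ENNReal BigOperators

noncomputable def screenedSeminorm (I : Set ℝ) (r : ℝ) (f : ℝ → ℝ) : ℝ≥0∞ :=
  (∫⁻ x in I, ∫⁻ y in I ∩ Set.Ioo (x - r) (x + r),
      ENNReal.ofReal ((f y - f x) ^ 2 / (y - x) ^ 2)) ^ (1 / 2 : ℝ)

def LocIntOn (I : Set ℝ) (f : ℝ → ℝ) : Prop :=
  ∀ s : Set ℝ, s ⊆ I → MeasurableSet s → Bornology.IsBounded s →
    MeasureTheory.IntegrableOn f s

noncomputable def avgOn (J : Set ℝ) (f : ℝ → ℝ) : ℝ :=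
  (MeasureTheory.volume J).toReal⁻¹ * ∫ x in J, f x

/-- The nonlocal seminorm `S(f)` on `E₁ ∪ E₂` with `E₁ = (x₀, x₁)`, `E₂ = (x₂, +∞)`,
`I₂ = (x₂, x₂ + 2)`. -/
noncomputable def Sseminorm (x₀ x₁ x₂ : ℝ) (f : ℝ → ℝ) : ℝ≥0∞ :=
  screenedSeminorm (Set.Ioo x₀ x₁) 1 f + screenedSeminorm (Set.Ioi x₂) 1 f +
    ENNReal.ofReal |avgOn (Set.Ioo x₀ x₁) f - avgOn (Set.Ioo x₂ (x₂ + 2)) f|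

/-- The infimum of `|f̃|_{Ḣ^{1/2}(ℝ)}` over all locally integrable extensions `f̃` of `f`
(i.e. `f̃ = f` a.e. on `E₁ ∪ E₂`). -/
noncomputable def extensionInf (x₀ x₁ x₂ : ℝ) (f : ℝ → ℝ) : ℝ≥0∞ :=
  sInf {s : ℝ≥0∞ | ∃ g : ℝ → ℝ, LocIntOn Set.univ g ∧
    (∀ᵐ x ∂volume.restrict (Set.Ioo x₀ x₁ ∪ Set.Ioi x₂), g x = f x) ∧
    s = screenedSeminorm Set.univ 1 g}

/-- The integrand of the screened energy, cut off at distance `r`. -/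
noncomputable def screenedKernel (r : ℝ) (f : ℝ → ℝ) (x y : ℝ) : ℝ≥0∞ :=
  if |y - x| < r then ENNReal.ofReal ((f y - f x) ^ 2 / (y - x) ^ 2) else 0

/-- The square of the screened seminorm. -/
noncomputable def screenedEnergy (I : Set ℝ) (r : ℝ) (f : ℝ → ℝ) : ℝ≥0∞ :=
  ∫⁻ x in I, ∫⁻ y in I, screenedKernel r f x y

lemma screenedSeminorm_eq (I : Set ℝ) (r : ℝ) (f : ℝ → ℝ) :
    screenedSeminorm I r f = screenedEnergy I r f ^ (1 / 2 : ℝ) := by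
  unfold screenedSeminorm screenedEnergy
  congr 1
  refine lintegral_congr fun x => ?_
  rw [inter_comm, ← Measure.restrict_restrict measurableSet_Ioo,
    ← lintegral_indicator measurableSet_Ioo]
  refine lintegral_congr fun y => ?_
  simp only [indicator, screenedKernel, mem_Ioo, abs_lt]
  congr 1
  exact propext ⟨fun h => ⟨by linarith [h.1], by linarith [h.2]⟩,
    fun h => ⟨by linarith [h.1], by linarith [h.2]⟩⟩

lemma measurable_screenedKernel {f : ℝ → ℝ} (hf : Measurable f) (r : ℝ) :
    Measurable fun p : ℝ × ℝ => screenedKernel r f p.1 p.2 := by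
  unfold screenedKernel
  exact Measurable.ite (measurableSet_lt (by fun_prop) (by fun_prop)) (by fun_prop) (by fun_prop)

lemma screenedKernel_mono {r R : ℝ} (h : r ≤ R) (f : ℝ → ℝ) (x y : ℝ) :
    screenedKernel r f x y ≤ screenedKernel R f x y := by
  unfold screenedKernel
  split_ifs with h1 h2
  · exact le_rfl
  · exact absurd (h1.trans_le h) h2
  · exact zero_le
  · exact le_rfl

lemma screenedEnergy_mono {I J : Set ℝ} (hIJ : I ⊆ J) {r R : ℝ} (h : r ≤ R) (f : ℝ → ℝ) :
    screenedEnergy I r f ≤ screenedEnergy J R f :=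
  lintegral_mono' (Measure.restrict_mono hIJ le_rfl) fun x =>
    lintegral_mono' (Measure.restrict_mono hIJ le_rfl) fun y => screenedKernel_mono h f x y

lemma screenedEnergy_congr_set {I J : Set ℝ} (h : I =ᵐ[volume] J) (r : ℝ) (f : ℝ → ℝ) :
    screenedEnergy I r f = screenedEnergy J r f := by
  simp only [screenedEnergy, Measure.restrict_congr_set h]

lemma screenedEnergy_congr {I : Set ℝ} {f g : ℝ → ℝ} (h : f =ᵐ[volume.restrict I] g) (r : ℝ) :
    screenedEnergy I r f = screenedEnergy I r g := by
  refine lintegral_congr_ae (h.mono fun x hx => lintegral_congr_ae (h.mono fun y hy => ?_))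
  simp only [screenedKernel, hx, hy]

lemma ofReal_add_sq_le (a b : ℝ) :
    ENNReal.ofReal ((a + b) ^ 2) ≤ 2 * ENNReal.ofReal (a ^ 2) + 2 * ENNReal.ofReal (b ^ 2) := by
  rw [← ENNReal.ofReal_ofNat 2, ← ENNReal.ofReal_mul (by norm_num),
    ← ENNReal.ofReal_mul (by norm_num), ← ENNReal.ofReal_add (by positivity) (by positivity)]
  exact ENNReal.ofReal_le_ofReal (by nlinarith [sq_nonneg (a - b)])

lemma screenedKernel_add_le (r : ℝ) (f g : ℝ → ℝ) (x y : ℝ) :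
    screenedKernel r (fun t => f t + g t) x y ≤
      2 * screenedKernel r f x y + 2 * screenedKernel r g x y := by
  unfold screenedKernel
  split_ifs
  · have := ofReal_add_sq_le ((f y - f x) / (y - x)) ((g y - g x) / (y - x))
    simp only [div_pow] at this
    refine le_trans (le_of_eq ?_) this
    rw [← add_div, div_pow]
    ring_nf
  · simp

lemma screenedEnergy_add_le {f g : ℝ → ℝ} (hf : Measurable f) (hg : Measurable g)
    (I : Set ℝ) (r : ℝ) :
    screenedEnergy I r (fun t => f t + g t) ≤
      2 * screenedEnergy I r f + 2 * screenedEnergy I r g := by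
  have mf := measurable_screenedKernel hf r
  have mg := measurable_screenedKernel hg r
  calc screenedEnergy I r (fun t => f t + g t)
      ≤ ∫⁻ x in I, ∫⁻ y in I, (2 * screenedKernel r f x y + 2 * screenedKernel r g x y) :=
        lintegral_mono fun x => lintegral_mono fun y => screenedKernel_add_le r f g x y
    _ = ∫⁻ x in I, (2 * (∫⁻ y in I, screenedKernel r f x y) +
          2 * ∫⁻ y in I, screenedKernel r g x y) := by
        refine lintegral_congr fun x => ?_
        have mfx : Measurable (screenedKernel r f x) := mf.of_uncurry_left
        have mgx : Measurable (screenedKernel r g x) := mg.of_uncurry_left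
        rw [lintegral_add_left (mfx.const_mul 2), lintegral_const_mul _ mfx,
          lintegral_const_mul _ mgx]
    _ = _ := by
        rw [lintegral_add_left (mf.lintegral_prod_right'.const_mul 2),
          lintegral_const_mul _ mf.lintegral_prod_right',
          lintegral_const_mul _ mg.lintegral_prod_right']
        rfl

lemma screenedEnergy_neg (I : Set ℝ) (r : ℝ) (f : ℝ → ℝ) :
    screenedEnergy I r (fun t => -f t) = screenedEnergy I r f := by
  refine lintegral_congr fun x => lintegral_congr fun y => ?_
  simp only [screenedKernel]
  rw [show (-f y - -f x) ^ 2 = (f y - f x) ^ 2 by ring]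

lemma setLIntegral_comp_le {T : ℝ → ℝ} (hT : Measurable T) {c : ℝ≥0∞}
    (hc : (volume : Measure ℝ).map T ≤ c • volume) {K E : Set ℝ} (hE : MeasurableSet E)
    (hK : MeasurableSet K) (hKE : MapsTo T K E) {h : ℝ → ℝ≥0∞} (hh : Measurable h) :
    ∫⁻ x in K, h (T x) ≤ c * ∫⁻ x in E, h x :=
  calc ∫⁻ x in K, h (T x) = ∫⁻ x in K, E.indicator h (T x) :=
        setLIntegral_congr_fun hK fun x hx => by simp [indicator, hKE hx]
    _ ≤ ∫⁻ x, E.indicator h (T x) := setLIntegral_le_lintegral _ _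
    _ = ∫⁻ x, E.indicator h x ∂(volume.map T) := (lintegral_map (hh.indicator hE) hT).symm
    _ ≤ ∫⁻ x, E.indicator h x ∂(c • volume) := lintegral_mono' hc le_rfl
    _ = c * ∫⁻ x in E, h x := by rw [lintegral_smul_measure, lintegral_indicator hE, smul_eq_mul]

lemma screenedEnergy_comp_le {T : ℝ → ℝ} (hT : Measurable T)
    (hlip : ∀ x y, |T y - T x| ≤ |y - x|) {c : ℝ≥0∞}
    (hc : (volume : Measure ℝ).map T ≤ c • volume) {K E : Set ℝ} (hE : MeasurableSet E)
    (hK : MeasurableSet K) (hKE : MapsTo T K E) {f : ℝ → ℝ} (hf : Measurable f) (r : ℝ) :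
    screenedEnergy K r (fun t => f (T t)) ≤ c * (c * screenedEnergy E r f) := by
  have mf := measurable_screenedKernel hf r
  have key (x y : ℝ) : screenedKernel r (fun t => f (T t)) x y ≤ screenedKernel r f (T x) (T y) := by
    unfold screenedKernel
    split_ifs with h1 h2
    · refine ENNReal.ofReal_le_ofReal ?_
      rcases eq_or_ne (T y) (T x) with h | h
      · simp [h]
      · have : 0 < (T y - T x) ^ 2 := by have := sub_ne_zero.2 h; positivity
        have := sq_le_sq.2 (hlip x y)
        gcongr
    · exact absurd ((hlip x y).trans_lt h1) h2
    · exact zero_le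
    · exact le_rfl
  calc screenedEnergy K r (fun t => f (T t))
      ≤ ∫⁻ x in K, ∫⁻ y in K, screenedKernel r f (T x) (T y) :=
        lintegral_mono fun x => lintegral_mono fun y => key x y
    _ ≤ ∫⁻ x in K, c * ∫⁻ y in E, screenedKernel r f (T x) y :=
        lintegral_mono fun x => setLIntegral_comp_le hT hc hE hK hKE mf.of_uncurry_left
    _ ≤ c * ∫⁻ x in E, c * ∫⁻ y in E, screenedKernel r f x y :=
        setLIntegral_comp_le hT hc hE hK hKE
          (h := fun x => c * ∫⁻ y in E, screenedKernel r f x y)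
          (mf.lintegral_prod_right'.const_mul c)
    _ = _ := by rw [lintegral_const_mul _ mf.lintegral_prod_right']; rfl

lemma map_midpoint_le (x : ℝ) :
    (volume : Measure ℝ).map (fun y => (x + y) / 2) ≤ (2 : ℝ≥0∞) • volume := by
  have h1 : (fun y : ℝ => (x + y) / 2) = (fun y => x / 2 + y) ∘ (fun y => 2⁻¹ * y) := by
    ext y; simp; ring
  rw [h1, ← Measure.map_map (by fun_prop) (by fun_prop),
    Real.map_volume_mul_left (by norm_num), Measure.map_smul,
    map_add_left_eq_self]
  simp

lemma screenedKernel_two_mul_le (r : ℝ) (f : ℝ → ℝ) (x y : ℝ) :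
    2 * screenedKernel (2 * r) f x y ≤
      screenedKernel r f x ((x + y) / 2) + screenedKernel r f y ((y + x) / 2) := by
  have e1 : (x + y) / 2 - x = (y - x) / 2 := by ring
  have e2 : (y + x) / 2 - y = -((y - x) / 2) := by ring
  have e3 : |(y - x) / 2| < r ↔ |y - x| < 2 * r := by
    rw [abs_div, abs_two, div_lt_iff₀ (by norm_num), mul_comm]
  unfold screenedKernel
  simp only [e1, e2, abs_neg, e3]
  split_ifs with h
  · rw [add_comm y x]
    rcases eq_or_ne y x with rfl | hyx
    · simp
    have : 0 < (y - x) ^ 2 := by have := sub_ne_zero.2 hyx; positivity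
    rw [← ENNReal.ofReal_ofNat 2, ← ENNReal.ofReal_mul (by norm_num),
      ← ENNReal.ofReal_add (by positivity) (by positivity)]
    refine ENNReal.ofReal_le_ofReal ?_
    rw [neg_sq, div_pow, ← add_div, ← mul_div_assoc, div_le_div_iff₀ this (by positivity)]
    have := sq_nonneg ((f ((x + y) / 2) - f x) + (f ((x + y) / 2) - f y))
    nlinarith
  · simp

lemma screenedEnergy_two_mul_le {I : Set ℝ} (hI : MeasurableSet I) (hconv : Convex ℝ I)
    {f : ℝ → ℝ} (hf : Measurable f) (r : ℝ) :
    screenedEnergy I (2 * r) f ≤ 2 * screenedEnergy I r f := by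
  have mf := measurable_screenedKernel hf r
  have half (x : ℝ) (hx : x ∈ I) :
      ∫⁻ y in I, screenedKernel r f x ((x + y) / 2) ≤ 2 * ∫⁻ y in I, screenedKernel r f x y :=
    setLIntegral_comp_le (T := fun y => (x + y) / 2) (by fun_prop) (map_midpoint_le x) hI hI
      (fun y hy => by
        have := hconv hx hy (by norm_num : (0 : ℝ) ≤ 1 / 2) (by norm_num : (0 : ℝ) ≤ 1 / 2)
          (by norm_num)
        simp only [smul_eq_mul] at this
        convert this using 1; ring) mf.of_uncurry_left
  have m1 : Measurable fun p : ℝ × ℝ => screenedKernel r f p.1 ((p.1 + p.2) / 2) :=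
    mf.comp (measurable_fst.prodMk ((measurable_fst.add measurable_snd).div_const 2))
  have hhalf : ∫⁻ x in I, ∫⁻ y in I, screenedKernel r f x ((x + y) / 2) ≤
      2 * screenedEnergy I r f := by
    refine (setLIntegral_mono' hI half).trans ?_
    rw [lintegral_const_mul _ mf.lintegral_prod_right']; rfl
  have m2 : Measurable fun p : ℝ × ℝ => screenedKernel (2 * r) f p.1 p.2 :=
    measurable_screenedKernel hf _
  have key : 2 * screenedEnergy I (2 * r) f ≤ 2 * (2 * screenedEnergy I r f) :=
    calc 2 * screenedEnergy I (2 * r) f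
        = ∫⁻ x in I, ∫⁻ y in I, 2 * screenedKernel (2 * r) f x y := by
          unfold screenedEnergy
          rw [← lintegral_const_mul _ m2.lintegral_prod_right']
          exact lintegral_congr fun x => (lintegral_const_mul _ m2.of_uncurry_left).symm
      _ ≤ ∫⁻ x in I, ∫⁻ y in I,
            (screenedKernel r f x ((x + y) / 2) + screenedKernel r f y ((y + x) / 2)) :=
          lintegral_mono fun x => lintegral_mono fun y => screenedKernel_two_mul_le r f x y
      _ = (∫⁻ x in I, ∫⁻ y in I, screenedKernel r f x ((x + y) / 2)) +
            ∫⁻ x in I, ∫⁻ y in I, screenedKernel r f y ((y + x) / 2) := by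
          rw [← lintegral_add_left m1.lintegral_prod_right']
          refine lintegral_congr fun x => lintegral_add_left ?_ _
          exact m1.comp measurable_prodMk_left
      _ = (∫⁻ x in I, ∫⁻ y in I, screenedKernel r f x ((x + y) / 2)) +
            ∫⁻ x in I, ∫⁻ y in I, screenedKernel r f x ((x + y) / 2) := by
          congr 1
          exact (lintegral_lintegral_swap m1.aemeasurable).symm
      _ ≤ 2 * screenedEnergy I r f + 2 * screenedEnergy I r f := add_le_add hhalf hhalf
      _ = _ := (two_mul _).symm
  exact (ENNReal.mul_le_mul_iff_right (by simp) (by simp)).1 key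

lemma exists_screenedEnergy_le {I : Set ℝ} (hI : MeasurableSet I) (hconv : Convex ℝ I)
    {r : ℝ} (hr : 0 < r) (R : ℝ) :
    ∃ C : ℝ≥0∞, C ≠ ⊤ ∧ ∀ f : ℝ → ℝ, Measurable f →
      screenedEnergy I R f ≤ C * screenedEnergy I r f := by
  obtain ⟨n, hn⟩ := pow_unbounded_of_one_lt (R / r) (one_lt_two (α := ℝ))
  refine ⟨2 ^ n, by simp, fun f hf => ?_⟩
  have iter (k : ℕ) : screenedEnergy I (2 ^ k * r) f ≤ 2 ^ k * screenedEnergy I r f := by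
    induction k with
    | zero => simp
    | succ k ih =>
      calc screenedEnergy I (2 ^ (k + 1) * r) f
          = screenedEnergy I (2 * (2 ^ k * r)) f := by ring_nf
        _ ≤ 2 * (2 ^ k * screenedEnergy I r f) :=
          (screenedEnergy_two_mul_le hI hconv hf _).trans (by gcongr)
        _ = _ := by ring
  refine (screenedEnergy_mono subset_rfl ((div_lt_iff₀ hr).1 hn).le f).trans ?_
  exact iter n

lemma volume_mul_ofReal_sq_sub_avgOn_le {B : Set ℝ} (hB0 : volume B ≠ 0)
    (hBtop : volume B ≠ ⊤) {f : ℝ → ℝ} (hf : IntegrableOn f B) (c : ℝ) :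
    volume B * ENNReal.ofReal ((avgOn B f - c) ^ 2) ≤
      ∫⁻ y in B, ENNReal.ofReal ((f y - c) ^ 2) := by
  rcases eq_or_ne (∫⁻ y in B, ENNReal.ofReal ((f y - c) ^ 2)) ⊤ with h | h
  · simp [h]
  have hpos : 0 < (volume B).toReal := ENNReal.toReal_pos hB0 hBtop
  have : IsFiniteMeasure (volume.restrict B) := ⟨by simpa using hBtop.lt_top⟩
  have hsq : Integrable (fun y => (f y - c) ^ 2) (volume.restrict B) := by
    refine ⟨(hf.aestronglyMeasurable.sub aestronglyMeasurable_const).pow 2, ?_⟩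
    rw [hasFiniteIntegral_iff_ofReal (ae_of_all _ fun y => sq_nonneg _)]
    exact h.lt_top
  set a := avgOn B f with ha
  have hint : ∫ y in B, f y = (volume B).toReal * a := by
    rw [ha, avgOn, mul_inv_cancel_left₀ hpos.ne']
  have hi : Integrable (fun y => f y - a) (volume.restrict B) := hf.sub (integrable_const a)
  have hle : ∫ y in B, ((a - c) ^ 2 + 2 * (a - c) * (f y - a)) ≤ ∫ y in B, (f y - c) ^ 2 := by
    refine integral_mono ?_ hsq fun y => ?_
    · exact (integrable_const _).add (hi.const_mul _)
    · simp only
      nlinarith [sq_nonneg (f y - a)]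
  rw [integral_add (integrable_const _) (hi.const_mul _),
    integral_const_mul, integral_sub hf (integrable_const a), hint] at hle
  simp only [integral_const, smul_eq_mul, Measure.real, Measure.restrict_apply_univ,
    sub_self, mul_zero, add_zero] at hle
  rw [← ofReal_integral_eq_lintegral_ofReal hsq (ae_of_all _ fun y => sq_nonneg _)]
  calc volume B * ENNReal.ofReal ((a - c) ^ 2)
      = ENNReal.ofReal ((volume B).toReal * (a - c) ^ 2) := by
        rw [ENNReal.ofReal_mul hpos.le, ENNReal.ofReal_toReal hBtop]
    _ ≤ _ := ENNReal.ofReal_le_ofReal hle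

lemma ofReal_sq_sub_le_screenedKernel {R : ℝ} (f : ℝ → ℝ) {x y : ℝ} (h : |y - x| < R) :
    ENNReal.ofReal ((f y - f x) ^ 2) ≤ ENNReal.ofReal (R ^ 2) * screenedKernel R f x y := by
  rw [screenedKernel, if_pos h, ← ENNReal.ofReal_mul (sq_nonneg R)]
  refine ENNReal.ofReal_le_ofReal ?_
  rcases eq_or_ne y x with rfl | hyx
  · simp
  have h1 : 0 < (y - x) ^ 2 := by have := sub_ne_zero.2 hyx; positivity
  have h2 : (y - x) ^ 2 ≤ R ^ 2 := sq_le_sq.2 (h.le.trans (le_abs_self R))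
  rw [← mul_div_assoc, le_div_iff₀ h1, mul_comm]
  gcongr

lemma exists_poincare {I A B : Set ℝ} (hI : MeasurableSet I) (hconv : Convex ℝ I)
    (hA : MeasurableSet A) (hB : MeasurableSet B) (hAI : A ⊆ I) (hBI : B ⊆ I)
    (hAb : Bornology.IsBounded A) (hBb : Bornology.IsBounded B) (hB0 : volume B ≠ 0)
    {r : ℝ} (hr : 0 < r) :
    ∃ C : ℝ≥0∞, C ≠ ⊤ ∧ ∀ f : ℝ → ℝ, Measurable f → IntegrableOn f B →
      ∫⁻ x in A, ENNReal.ofReal ((f x - avgOn B f) ^ 2) ≤ C * screenedEnergy I r f := by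
  have hBtop : volume B ≠ ⊤ := hBb.measure_lt_top.ne
  obtain ⟨M, hM⟩ := (hAb.union hBb).subset_ball (0 : ℝ)
  have hdist {x y : ℝ} (hx : x ∈ A) (hy : y ∈ B) : |y - x| < 2 * M := by
    have h1 : |x| < M := by simpa using hM (Or.inl hx)
    have h2 : |y| < M := by simpa using hM (Or.inr hy)
    linarith [abs_sub y x]
  obtain ⟨C, hC, hCE⟩ := exists_screenedEnergy_le hI hconv hr (2 * M)
  refine ⟨(volume B)⁻¹ * (ENNReal.ofReal ((2 * M) ^ 2) * C),
    ENNReal.mul_ne_top (by simpa using hB0) (ENNReal.mul_ne_top ENNReal.ofReal_ne_top hC),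
    fun f hf hfB => ?_⟩
  have key : volume B * ∫⁻ x in A, ENNReal.ofReal ((f x - avgOn B f) ^ 2) ≤
      ENNReal.ofReal ((2 * M) ^ 2) * screenedEnergy I (2 * M) f :=
    calc volume B * ∫⁻ x in A, ENNReal.ofReal ((f x - avgOn B f) ^ 2)
        = ∫⁻ x in A, volume B * ENNReal.ofReal ((avgOn B f - f x) ^ 2) := by
          rw [← lintegral_const_mul' _ _ hBtop]
          refine lintegral_congr fun x => ?_
          rw [← neg_sq, neg_sub]
      _ ≤ ∫⁻ x in A, ∫⁻ y in B, ENNReal.ofReal ((f y - f x) ^ 2) :=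
          lintegral_mono fun x => volume_mul_ofReal_sq_sub_avgOn_le hB0 hBtop hfB (f x)
      _ ≤ ∫⁻ x in A, ∫⁻ y in B, ENNReal.ofReal ((2 * M) ^ 2) * screenedKernel (2 * M) f x y :=
          setLIntegral_mono' hA fun x hx => setLIntegral_mono' hB fun y hy =>
            ofReal_sq_sub_le_screenedKernel f (hdist hx hy)
      _ ≤ ∫⁻ x in I, ∫⁻ y in I, ENNReal.ofReal ((2 * M) ^ 2) * screenedKernel (2 * M) f x y :=
          lintegral_mono' (Measure.restrict_mono hAI le_rfl) fun x =>
            lintegral_mono' (Measure.restrict_mono hBI le_rfl) le_rfl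
      _ = _ := by simp only [lintegral_const_mul' _ _ ENNReal.ofReal_ne_top, screenedEnergy]
  rw [mul_assoc, mul_assoc, ← ENNReal.div_eq_inv_mul, ENNReal.le_div_iff_mul_le (by simp [hB0])
    (by simp [hBtop]), mul_comm]
  exact key.trans (by gcongr; exact hCE f hf)

lemma exists_ofReal_sq_avgOn_sub_le {I A B : Set ℝ} (hI : MeasurableSet I) (hconv : Convex ℝ I)
    (hA : MeasurableSet A) (hB : MeasurableSet B) (hAI : A ⊆ I) (hBI : B ⊆ I)
    (hAb : Bornology.IsBounded A) (hBb : Bornology.IsBounded B) (hA0 : volume A ≠ 0)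
    (hB0 : volume B ≠ 0) {r : ℝ} (hr : 0 < r) :
    ∃ C : ℝ≥0∞, C ≠ ⊤ ∧ ∀ f : ℝ → ℝ, Measurable f → IntegrableOn f A → IntegrableOn f B →
      ENNReal.ofReal ((avgOn A f - avgOn B f) ^ 2) ≤ C * screenedEnergy I r f := by
  obtain ⟨C, hC, h⟩ := exists_poincare hI hconv hA hB hAI hBI hAb hBb hB0 hr
  have hAtop : volume A ≠ ⊤ := hAb.measure_lt_top.ne
  refine ⟨(volume A)⁻¹ * C, ENNReal.mul_ne_top (by simpa using hA0) hC, fun f hf hfA hfB => ?_⟩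
  rw [mul_assoc, ← ENNReal.div_eq_inv_mul, ENNReal.le_div_iff_mul_le (by simp [hA0])
    (by simp [hAtop]), mul_comm]
  exact (volume_mul_ofReal_sq_sub_avgOn_le hA0 hAtop hfA _).trans (h f hf hfB)

lemma locIntOn_univ_of_screenedEnergy_lt_top {g : ℝ → ℝ} (hg : Measurable g) {r : ℝ} (hr : 0 < r)
    (h : screenedEnergy univ r g < ⊤) : LocIntOn univ g := by
  intro s _ hs hsb
  obtain ⟨M, hM⟩ := hsb.subset_ball (0 : ℝ)
  obtain ⟨C, hC, hCE⟩ := exists_screenedEnergy_le MeasurableSet.univ convex_univ hr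
    (2 * max M 1)
  set R := 2 * max M 1
  have hfin : screenedEnergy univ R g < ⊤ :=
    (hCE g hg).trans_lt (ENNReal.mul_lt_top hC.lt_top h)
  have mg := measurable_screenedKernel hg R
  simp only [screenedEnergy, Measure.restrict_univ] at hfin
  have hae : ∀ᵐ x, ∫⁻ y, screenedKernel R g x y < ⊤ :=
    ae_lt_top mg.lintegral_prod_right' hfin.ne
  have hfreq : ∃ᵐ x ∂(volume : Measure ℝ), x ∈ Metric.ball (0 : ℝ) (max M 1) := by
    rw [frequently_ae_mem_iff]
    exact (Metric.measure_ball_pos volume 0 (by positivity)).ne'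
  obtain ⟨x, hx, hxfin⟩ := (hfreq.and_eventually hae).exists
  have : IsFiniteMeasure (volume.restrict s) := ⟨by simpa using hsb.measure_lt_top⟩
  have hmem : MemLp (fun y => g y - g x) 2 (volume.restrict s) := by
    rw [memLp_two_iff_integrable_sq (by fun_prop)]
    refine ⟨by fun_prop, ?_⟩
    rw [hasFiniteIntegral_iff_ofReal (ae_of_all _ fun y => sq_nonneg _)]
    calc ∫⁻ y in s, ENNReal.ofReal ((g y - g x) ^ 2)
        ≤ ∫⁻ y in s, ENNReal.ofReal (R ^ 2) * screenedKernel R g x y := by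
          refine setLIntegral_mono' hs fun y hy => ofReal_sq_sub_le_screenedKernel g ?_
          have h1 : |x| < max M 1 := by simpa using hx
          have h2 : |y| < M := by simpa using hM hy
          linarith [abs_sub y x, le_max_left M 1]
      _ ≤ ∫⁻ y, ENNReal.ofReal (R ^ 2) * screenedKernel R g x y := setLIntegral_le_lintegral _ _
      _ = ENNReal.ofReal (R ^ 2) * ∫⁻ y, screenedKernel R g x y :=
          lintegral_const_mul' _ _ ENNReal.ofReal_ne_top
      _ < ⊤ := ENNReal.mul_lt_top ENNReal.ofReal_lt_top hxfin
  have := (hmem.integrable one_le_two).add (integrable_const (g x))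
  simpa [IntegrableOn, Pi.add_def] using this

lemma screenedKernel_mul_le {φ : ℝ → ℝ} {Λ : ℝ} (hφ : ∀ x, |φ x| ≤ 1)
    (hlip : ∀ x y, |φ y - φ x| ≤ Λ * |y - x|) (u : ℝ → ℝ) (r x y : ℝ) :
    screenedKernel r (fun t => φ t * u t) x y ≤
      2 * screenedKernel r u x y + 2 * ENNReal.ofReal (Λ ^ 2) * ENNReal.ofReal (u x ^ 2) := by
  unfold screenedKernel
  split_ifs
  · rcases eq_or_ne y x with rfl | hyx
    · simp
    have h0 : 0 < (y - x) ^ 2 := by have := sub_ne_zero.2 hyx; positivity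
    have := ofReal_add_sq_le (φ y * ((u y - u x) / (y - x))) (u x * ((φ y - φ x) / (y - x)))
    refine le_trans (le_of_eq ?_) (this.trans (add_le_add ?_ ?_))
    · rw [← div_pow]
      congr 2
      ring
    · gcongr
      rw [mul_pow, div_pow]
      exact mul_le_of_le_one_left (by positivity) ((sq_le_one_iff_abs_le_one _).2 (hφ y))
    · rw [mul_assoc, ← ENNReal.ofReal_mul (sq_nonneg Λ)]
      gcongr
      rw [mul_pow, div_pow, mul_comm]
      gcongr
      rw [div_le_iff₀ h0, ← mul_pow]
      refine sq_le_sq.2 ((hlip x y).trans ?_)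
      rw [abs_mul]
      gcongr
      exact le_abs_self Λ
  · simp

lemma screenedEnergy_mul_le {φ : ℝ → ℝ} {Λ : ℝ} (hφ : ∀ x, |φ x| ≤ 1)
    (hlip : ∀ x y, |φ y - φ x| ≤ Λ * |y - x|) {u : ℝ → ℝ} (hu : Measurable u) {r : ℝ}
    {K : Set ℝ} (hK : MeasurableSet K)
    (hsupp : ∀ x y, |y - x| < r → φ x ≠ 0 → x ∈ K ∧ y ∈ K) :
    screenedEnergy univ r (fun t => φ t * u t) ≤
      2 * screenedEnergy K r u +
        2 * ENNReal.ofReal (Λ ^ 2) * volume K * ∫⁻ x in K, ENNReal.ofReal (u x ^ 2) := by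
  have mu := measurable_screenedKernel hu r
  have hzero (x y : ℝ) (h : ¬ (x ∈ K ∧ y ∈ K)) :
      screenedKernel r (fun t => φ t * u t) x y = 0 := by
    unfold screenedKernel
    split_ifs with hxy
    · have h1 : φ x = 0 := by
        by_contra h1
        exact h (hsupp x y hxy h1)
      have h2 : φ y = 0 := by
        by_contra h2
        exact h (hsupp y x (by rwa [abs_sub_comm]) h2).symm
      simp [h1, h2]
    · rfl
  have musq : Measurable fun x => ENNReal.ofReal (u x ^ 2) := by fun_prop
  calc screenedEnergy univ r (fun t => φ t * u t)
      = ∫⁻ x in K, ∫⁻ y in K, screenedKernel r (fun t => φ t * u t) x y := by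
        simp only [screenedEnergy, Measure.restrict_univ]
        rw [← lintegral_indicator hK]
        refine lintegral_congr fun x => ?_
        by_cases hx : x ∈ K
        · rw [indicator_of_mem hx, ← lintegral_indicator hK]
          refine lintegral_congr fun y => ?_
          by_cases hy : y ∈ K
          · rw [indicator_of_mem hy]
          · rw [indicator_of_notMem hy, hzero x y (by tauto)]
        · rw [indicator_of_notMem hx]
          simp [fun y => hzero x y fun h => hx h.1]
    _ ≤ ∫⁻ x in K, ∫⁻ y in K, (2 * screenedKernel r u x y +
          2 * ENNReal.ofReal (Λ ^ 2) * ENNReal.ofReal (u x ^ 2)) :=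
        lintegral_mono fun x => lintegral_mono fun y => screenedKernel_mul_le hφ hlip u r x y
    _ = ∫⁻ x in K, (2 * (∫⁻ y in K, screenedKernel r u x y) +
          2 * ENNReal.ofReal (Λ ^ 2) * volume K * ENNReal.ofReal (u x ^ 2)) := by
        refine lintegral_congr fun x => ?_
        have mux : Measurable (screenedKernel r u x) := mu.of_uncurry_left
        rw [lintegral_add_left (mux.const_mul 2), lintegral_const_mul _ mux, lintegral_const,
          Measure.restrict_apply_univ]
        ring
    _ = _ := by
        rw [lintegral_add_left (mu.lintegral_prod_right'.const_mul 2),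
          lintegral_const_mul _ mu.lintegral_prod_right', lintegral_const_mul _ musq]
        rfl

lemma map_volume_le_of_eq_or_eq_reflection {T : ℝ → ℝ} (hT : Measurable T) (a : ℝ)
    (h : ∀ x, T x = x ∨ T x = 2 * a - x) :
    (volume : Measure ℝ).map T ≤ (2 : ℝ≥0∞) • volume := by
  refine Measure.le_iff.2 fun s hs => ?_
  rw [Measure.map_apply hT hs, Measure.smul_apply, smul_eq_mul, two_mul]
  calc volume (T ⁻¹' s) ≤ volume (s ∪ (fun x => 2 * a - x) ⁻¹' s) := by
        refine measure_mono fun x hx => ?_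
        rcases h x with h | h
        · exact Or.inl (by simpa [h] using hx)
        · exact Or.inr (by simpa [h] using hx)
    _ ≤ volume s + volume ((fun x => 2 * a - x) ⁻¹' s) := measure_union_le _ _
    _ = volume s + volume s := by
        rw [(Measure.measurePreserving_sub_left volume (2 * a)).measure_preimage hs.nullMeasurableSet]

lemma screenedEnergy_comp_fold_left_le (a : ℝ) {K E : Set ℝ} (hE : MeasurableSet E)
    (hK : MeasurableSet K) (hKE : MapsTo (fun x => a + |x - a|) K E) {f : ℝ → ℝ}
    (hf : Measurable f) (r : ℝ) :
    screenedEnergy K r (fun t => f (a + |t - a|)) ≤ 2 * (2 * screenedEnergy E r f) := by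
  have hm : Measurable fun x : ℝ => a + |x - a| := (continuous_const.add
    (continuous_id.sub continuous_const).abs).measurable
  refine screenedEnergy_comp_le (T := fun x => a + |x - a|) hm (fun x y => ?_)
    (map_volume_le_of_eq_or_eq_reflection hm a fun x => ?_) hE hK hKE hf r
  · simpa using abs_abs_sub_abs_le (y - a) (x - a)
  · rcases abs_cases (x - a) with h | h
    · left; linarith
    · right; linarith

lemma screenedEnergy_comp_fold_right_le (b : ℝ) {K E : Set ℝ} (hE : MeasurableSet E)
    (hK : MeasurableSet K) (hKE : MapsTo (fun x => b - |b - x|) K E) {f : ℝ → ℝ}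
    (hf : Measurable f) (r : ℝ) :
    screenedEnergy K r (fun t => f (b - |b - t|)) ≤ 2 * (2 * screenedEnergy E r f) := by
  have hm : Measurable fun x : ℝ => b - |b - x| := (continuous_const.sub
    (continuous_const.sub continuous_id).abs).measurable
  refine screenedEnergy_comp_le (T := fun x => b - |b - x|) hm (fun x y => ?_)
    (map_volume_le_of_eq_or_eq_reflection hm b fun x => ?_) hE hK hKE hf r
  · simpa [abs_sub_comm] using abs_abs_sub_abs_le (b - x) (b - y)
  · rcases abs_cases (b - x) with h | h
    · left; linarith
    · right; linarith

/-- The piecewise linear cutoff equal to `1` on `[a, b]` and to `0` at distance `δ` from it. -/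
noncomputable def cutoff (a b δ x : ℝ) : ℝ :=
  max 0 (1 - max 0 (max (a - x) (x - b)) / δ)

lemma continuous_cutoff (a b δ : ℝ) : Continuous (cutoff a b δ) := by
  unfold cutoff; fun_prop

lemma abs_cutoff_le (a b x : ℝ) {δ : ℝ} (hδ : 0 < δ) : |cutoff a b δ x| ≤ 1 := by
  unfold cutoff
  have : 0 ≤ max 0 (max (a - x) (x - b)) / δ := div_nonneg (le_max_left _ _) hδ.le
  rw [abs_of_nonneg (le_max_left _ _)]
  exact max_le zero_le_one (by linarith)

lemma cutoff_eq_one {a b x : ℝ} (hx : x ∈ Icc a b) (δ : ℝ) : cutoff a b δ x = 1 := by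
  have : max 0 (max (a - x) (x - b)) = 0 :=
    max_eq_left (max_le (by linarith [hx.1]) (by linarith [hx.2]))
  simp [cutoff, this]

lemma mem_Ioo_of_cutoff_ne_zero {a b δ x : ℝ} (hδ : 0 < δ) (h : cutoff a b δ x ≠ 0) :
    x ∈ Ioo (a - δ) (b + δ) := by
  by_contra hx
  refine h (max_eq_left ?_)
  have : δ ≤ max 0 (max (a - x) (x - b)) := by
    by_contra! hlt
    have h1 := ((le_max_left _ _).trans (le_max_right _ _)).trans_lt hlt
    have h2 := ((le_max_right _ _).trans (le_max_right _ _)).trans_lt hlt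
    exact hx ⟨by linarith, by linarith⟩
  linarith [(one_le_div hδ).2 this]

lemma abs_cutoff_sub_le (a b x y : ℝ) {δ : ℝ} (hδ : 0 < δ) :
    |cutoff a b δ y - cutoff a b δ x| ≤ δ⁻¹ * |y - x| := by
  unfold cutoff
  have h1 : |max (a - x) (x - b) - max (a - y) (y - b)| ≤ |y - x| := by
    refine (abs_max_sub_max_le_max _ _ _ _).trans (max_le ?_ ?_)
    · exact le_of_eq (by ring_nf)
    · exact le_of_eq (by rw [abs_sub_comm]; ring_nf)
  have h2 : |max 0 (max (a - x) (x - b)) - max 0 (max (a - y) (y - b))| ≤ |y - x| := by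
    refine (abs_max_sub_max_le_max _ _ _ _).trans (max_le ?_ h1)
    simp
  refine (abs_max_sub_max_le_max _ _ _ _).trans (max_le ?_ ?_)
  · simp only [sub_self, abs_zero]; positivity
  · rw [sub_sub_sub_cancel_left, ← sub_div, abs_div, abs_of_pos hδ, div_eq_inv_mul]
    gcongr

/-- The square version of the nonlocal seminorm on `(x₀, x₁) ∪ (x₂, ∞)`. -/
noncomputable def nonlocalEnergy (x₀ x₁ x₂ : ℝ) (f : ℝ → ℝ) : ℝ≥0∞ :=
  screenedEnergy (Ioo x₀ x₁) 1 f + screenedEnergy (Ioi x₂) 1 f +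
    ENNReal.ofReal ((avgOn (Ioo x₀ x₁) f - avgOn (Ioo x₂ (x₂ + 2)) f) ^ 2)

lemma volume_Ioo_ne_zero {a b : ℝ} (h : a < b) : volume (Ioo a b) ≠ 0 := by
  simpa using h

lemma exists_nonlocalEnergy_le {x₀ x₁ : ℝ} (x₂ : ℝ) (h01 : x₀ < x₁) :
    ∃ C : ℝ≥0∞, C ≠ ⊤ ∧ ∀ g : ℝ → ℝ, Measurable g → LocIntOn univ g →
      nonlocalEnergy x₀ x₁ x₂ g ≤ C * screenedEnergy univ 1 g := by
  obtain ⟨C, hC, h⟩ := exists_ofReal_sq_avgOn_sub_le MeasurableSet.univ convex_univ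
    (measurableSet_Ioo (a := x₀) (b := x₁)) (measurableSet_Ioo (a := x₂) (b := x₂ + 2))
    (subset_univ _) (subset_univ _) (Metric.isBounded_Ioo _ _) (Metric.isBounded_Ioo _ _)
    (volume_Ioo_ne_zero h01) (volume_Ioo_ne_zero (by linarith)) one_pos
  refine ⟨1 + 1 + C, by simp [hC], fun g hg hgi => ?_⟩
  rw [add_mul, add_mul, one_mul]
  exact add_le_add (add_le_add (screenedEnergy_mono (subset_univ _) le_rfl g)
    (screenedEnergy_mono (subset_univ _) le_rfl g))
    (h g hg (hgi _ (subset_univ _) measurableSet_Ioo (Metric.isBounded_Ioo _ _))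
      (hgi _ (subset_univ _) measurableSet_Ioo (Metric.isBounded_Ioo _ _)))

lemma avgOn_congr {A : Set ℝ} {f g : ℝ → ℝ} (h : f =ᵐ[volume.restrict A] g) :
    avgOn A f = avgOn A g := by
  rw [avgOn, avgOn, integral_congr_ae h]

lemma setLIntegral_ofReal_sq_sub_le {f g : ℝ → ℝ} (hf : Measurable f) (hg : Measurable g)
    (a b : ℝ) (K : Set ℝ) :
    ∫⁻ x in K, ENNReal.ofReal ((f x - g x) ^ 2) ≤
      4 * (∫⁻ x in K, ENNReal.ofReal ((f x - a) ^ 2)) +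
        4 * (∫⁻ x in K, ENNReal.ofReal ((g x - b) ^ 2)) +
          2 * (ENNReal.ofReal ((a - b) ^ 2) * volume K) := by
  have hpt (x : ℝ) : ENNReal.ofReal ((f x - g x) ^ 2) ≤
      4 * ENNReal.ofReal ((f x - a) ^ 2) + 4 * ENNReal.ofReal ((g x - b) ^ 2) +
        2 * ENNReal.ofReal ((a - b) ^ 2) := by
    have h1 := ofReal_add_sq_le ((f x - a) + -(g x - b)) (a - b)
    have h2 := ofReal_add_sq_le (f x - a) (-(g x - b))
    rw [neg_sq] at h2
    rw [show f x - a + -(g x - b) + (a - b) = f x - g x by ring] at h1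
    refine h1.trans ((add_le_add_left (mul_le_mul_right h2 2) _).trans (le_of_eq ?_))
    ring
  have mf : Measurable fun x => ENNReal.ofReal ((f x - a) ^ 2) := by fun_prop
  have mg : Measurable fun x => ENNReal.ofReal ((g x - b) ^ 2) := by fun_prop
  refine (lintegral_mono hpt).trans (le_of_eq ?_)
  rw [lintegral_add_right _ measurable_const, lintegral_add_right _ (mg.const_mul 4),
    lintegral_const_mul _ mf, lintegral_const_mul _ mg, lintegral_const,
    Measure.restrict_apply_univ]
  ring

lemma exists_extension {x₀ x₁ x₂ : ℝ} (h01 : x₀ < x₁) (h12 : x₁ < x₂) :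
    ∃ C : ℝ≥0∞, C ≠ ⊤ ∧ ∀ f : ℝ → ℝ, Measurable f → IntegrableOn f (Ioo x₀ x₁) →
      IntegrableOn f (Ioo x₂ (x₂ + 2)) → ∃ g : ℝ → ℝ, Measurable g ∧
        (∀ x ∈ Ioo x₀ x₁ ∪ Ioi x₂, g x = f x) ∧
        screenedEnergy univ 1 g ≤ C * nonlocalEnergy x₀ x₁ x₂ f := by
  obtain ⟨δ, hδ, hδ01, hδ12, hδ1⟩ : ∃ δ : ℝ, 0 < δ ∧ 2 * δ ≤ x₁ - x₀ ∧ δ ≤ x₂ - x₁ ∧ δ ≤ 1 := by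
    refine ⟨min (min ((x₁ - x₀) / 2) (x₂ - x₁)) 1, by simp [h01, h12], ?_, ?_, min_le_right _ _⟩
    · linarith [(min_le_left (min ((x₁ - x₀) / 2) (x₂ - x₁)) 1).trans (min_le_left _ _)]
    · exact (min_le_left _ _).trans (min_le_right _ _)
  set K := Ioo (x₀ - 2 * δ) (x₁ + 2 * δ)
  have hKm : MeasurableSet K := measurableSet_Ioo
  have hKb : Bornology.IsBounded K := Metric.isBounded_Ioo _ _
  obtain ⟨C, hC, hCE⟩ := exists_screenedEnergy_le MeasurableSet.univ convex_univ hδ 1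
  obtain ⟨P, hP, hPE⟩ := exists_poincare (A := K) (B := Ioo x₀ x₁) (I := K) (r := δ) hKm
    (convex_Ioo _ _) hKm measurableSet_Ioo subset_rfl
    (Ioo_subset_Ioo (by linarith) (by linarith)) hKb (Metric.isBounded_Ioo _ _)
    (volume_Ioo_ne_zero h01) hδ
  obtain ⟨Q, hQ, hQE⟩ := exists_poincare (A := K) (B := Ioo x₂ (x₂ + 2)) (I := univ) (r := δ)
    MeasurableSet.univ convex_univ hKm measurableSet_Ioo (subset_univ _) (subset_univ _) hKb
    (Metric.isBounded_Ioo _ _) (volume_Ioo_ne_zero (by linarith)) hδ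
  set M := 2 * ENNReal.ofReal (δ⁻¹ ^ 2) * volume K
  have hKtop : volume K ≠ ⊤ := hKb.measure_lt_top.ne
  have hMtop : M ≠ ⊤ :=
    ENNReal.mul_ne_top (ENNReal.mul_ne_top (by simp) ENNReal.ofReal_ne_top) hKtop
  refine ⟨C * (2 * 4 + 2 * (2 * (2 * 16 + 2 * 4) +
    M * (4 * (P * 16) + 4 * (Q * 4) + 2 * volume K))), by finiteness,
    fun f hf hf1 hf2 => ?_⟩
  set D := nonlocalEnergy x₀ x₁ x₂ f
  set c₁ := avgOn (Ioo x₀ x₁) f with hc₁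
  set c₂ := avgOn (Ioo x₂ (x₂ + 2)) f with hc₂
  have hD1 : screenedEnergy (Icc x₀ x₁) δ f ≤ D := by
    rw [← screenedEnergy_congr_set Ioo_ae_eq_Icc]
    exact ((screenedEnergy_mono subset_rfl hδ1 f).trans le_self_add).trans le_self_add
  have hD2 : screenedEnergy (Ici x₂) δ f ≤ D := by
    rw [← screenedEnergy_congr_set Ioi_ae_eq_Ici]
    exact ((screenedEnergy_mono subset_rfl hδ1 f).trans le_add_self).trans le_self_add
  have hD3 : ENNReal.ofReal ((c₁ - c₂) ^ 2) ≤ D := le_add_self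
  set w₁ : ℝ → ℝ := fun x => f (x₁ - |x₁ - (x₀ + |x - x₀|)|) with hw₁
  set w₂ : ℝ → ℝ := fun x => f (x₂ + |x - x₂|) with hw₂
  have mw₁ : Measurable w₁ := hf.comp (by fun_prop)
  have mw₂ : Measurable w₂ := hf.comp (by fun_prop)
  have w₁_eq {x : ℝ} (hx : x ∈ Icc x₀ x₁) : w₁ x = f x := by
    simp only [hw₁, abs_of_nonneg (sub_nonneg.2 hx.1), add_sub_cancel,
      abs_of_nonneg (sub_nonneg.2 hx.2), sub_sub_cancel]
  have w₂_eq {x : ℝ} (hx : x ∈ Ioi x₂) : w₂ x = f x := by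
    simp only [hw₂, abs_of_nonneg (sub_nonneg.2 (mem_Ioi.1 hx).le), add_sub_cancel]
  have ae₁ : w₁ =ᵐ[volume.restrict (Ioo x₀ x₁)] f :=
    (ae_restrict_mem measurableSet_Ioo).mono fun x hx => w₁_eq (Ioo_subset_Icc_self hx)
  have ae₂ : w₂ =ᵐ[volume.restrict (Ioo x₂ (x₂ + 2))] f :=
    (ae_restrict_mem measurableSet_Ioo).mono fun x hx => w₂_eq hx.1
  have E₁ : screenedEnergy K δ w₁ ≤ 16 * D := by
    have mr : Measurable fun x => f (x₁ - |x₁ - x|) := hf.comp (by fun_prop)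
    have step₁ := screenedEnergy_comp_fold_left_le x₀ (K := K) (E := Icc x₀ (x₁ + 2 * δ))
      measurableSet_Icc hKm (fun x hx => by
        rcases abs_cases (x - x₀) with h | h <;> constructor <;> simp only <;>
          linarith [hx.1, hx.2]) mr δ
    have step₂ := screenedEnergy_comp_fold_right_le x₁ (K := Icc x₀ (x₁ + 2 * δ))
      (E := Icc x₀ x₁) measurableSet_Icc measurableSet_Icc (fun x hx => by
        rcases abs_cases (x₁ - x) with h | h <;> constructor <;> simp only <;>
          linarith [hx.1, hx.2]) hf δ
    calc screenedEnergy K δ w₁ ≤ 2 * (2 * (2 * (2 * D))) := by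
          refine step₁.trans ?_
          gcongr
          exact step₂.trans (by gcongr)
      _ = 16 * D := by ring
  have E₂ : screenedEnergy univ δ w₂ ≤ 4 * D := by
    have := screenedEnergy_comp_fold_left_le x₂ (K := univ) (E := Ici x₂)
      measurableSet_Ici MeasurableSet.univ (fun x _ => by simp) hf δ
    calc screenedEnergy univ δ w₂ ≤ 2 * (2 * D) := this.trans (by gcongr)
      _ = 4 * D := by ring
  have F₁ : ∫⁻ x in K, ENNReal.ofReal ((w₁ x - c₁) ^ 2) ≤ P * (16 * D) := by
    rw [hc₁, ← avgOn_congr ae₁]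
    exact (hPE w₁ mw₁ ((integrable_congr ae₁).2 hf1)).trans (by gcongr)
  have F₂ : ∫⁻ x in K, ENNReal.ofReal ((w₂ x - c₂) ^ 2) ≤ Q * (4 * D) := by
    rw [hc₂, ← avgOn_congr ae₂]
    exact (hQE w₂ mw₂ ((integrable_congr ae₂).2 hf2)).trans (by gcongr)
  set φ := cutoff x₀ x₁ δ with hφ
  have mφ : Measurable φ := (continuous_cutoff _ _ _).measurable
  set u : ℝ → ℝ := fun x => w₁ x + -w₂ x with hu
  have mu : Measurable u := mw₁.add mw₂.neg
  have Eu : screenedEnergy K δ u ≤ 2 * (16 * D) + 2 * (4 * D) := by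
    refine (screenedEnergy_add_le mw₁ mw₂.neg K δ).trans ?_
    gcongr
    refine (screenedEnergy_neg K δ w₂).trans_le ?_
    exact (screenedEnergy_mono (subset_univ K) le_rfl w₂).trans E₂
  have Fu : ∫⁻ x in K, ENNReal.ofReal (u x ^ 2) ≤
      4 * (P * (16 * D)) + 4 * (Q * (4 * D)) + 2 * (D * volume K) :=
    (setLIntegral_ofReal_sq_sub_le mw₁ mw₂ c₁ c₂ K).trans (by gcongr)
  have Eφ : screenedEnergy univ δ (fun x => φ x * u x) ≤
      2 * (2 * (16 * D) + 2 * (4 * D)) +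
        M * (4 * (P * (16 * D)) + 4 * (Q * (4 * D)) + 2 * (D * volume K)) := by
    refine (screenedEnergy_mul_le (K := K) (fun x => abs_cutoff_le x₀ x₁ x hδ)
      (fun x y => abs_cutoff_sub_le x₀ x₁ x y hδ) mu hKm fun x y hxy hx => ?_).trans
      (by gcongr)
    have hx' := mem_Ioo_of_cutoff_ne_zero hδ hx
    rw [abs_lt] at hxy
    exact ⟨⟨by linarith [hx'.1], by linarith [hx'.2]⟩,
      ⟨by linarith [hx'.1], by linarith [hx'.2]⟩⟩
  refine ⟨fun x => w₂ x + φ x * u x, mw₂.add (mφ.mul mu), ?_, ?_⟩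
  · rintro x (hx | hx)
    · have hx' := Ioo_subset_Icc_self hx
      simp only [hu, w₁_eq hx', hφ, cutoff_eq_one hx']
      ring
    · have : φ x = 0 := by
        by_contra h
        linarith [(mem_Ioo_of_cutoff_ne_zero hδ h).2, mem_Ioi.1 hx]
      simp only [this, w₂_eq hx, zero_mul, add_zero]
  · calc screenedEnergy univ 1 (fun x => w₂ x + φ x * u x)
        ≤ C * screenedEnergy univ δ (fun x => w₂ x + φ x * u x) := hCE _ (mw₂.add (mφ.mul mu))
      _ ≤ C * (2 * (4 * D) + 2 * (2 * (2 * (16 * D) + 2 * (4 * D)) +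
            M * (4 * (P * (16 * D)) + 4 * (Q * (4 * D)) + 2 * (D * volume K)))) := by
          gcongr
          refine (screenedEnergy_add_le mw₂ (mφ.mul mu) univ δ).trans ?_
          gcongr
          exact Eφ
      _ = _ := by ring

lemma rpow_half_sq_add_le (p q t : ℝ≥0∞) :
    (p ^ 2 + q ^ 2 + t ^ 2) ^ (1 / 2 : ℝ) ≤ p + q + t := by
  have : p ^ 2 + q ^ 2 + t ^ 2 ≤ (p + q + t) ^ (2 : ℝ) := by
    rw [ENNReal.rpow_two]
    calc p ^ 2 + q ^ 2 + t ^ 2 ≤ p ^ 2 + q ^ 2 + t ^ 2 + 2 * (p * q + p * t + q * t) := le_self_add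
      _ = _ := by ring
  rw [one_div]
  exact (ENNReal.rpow_inv_le_iff (by norm_num)).2 this

lemma add_le_three_mul_rpow_half (p q t : ℝ≥0∞) :
    p + q + t ≤ 3 * (p ^ 2 + q ^ 2 + t ^ 2) ^ (1 / 2 : ℝ) := by
  have h {s X : ℝ≥0∞} (hs : s ^ 2 ≤ X) : s ≤ X ^ (1 / 2 : ℝ) := by
    rw [one_div, ENNReal.le_rpow_inv_iff (by norm_num), ENNReal.rpow_two]
    exact hs
  calc p + q + t ≤ _ + _ + _ := add_le_add (add_le_add
        (h (X := p ^ 2 + q ^ 2 + t ^ 2) (by rw [add_assoc]; exact le_self_add))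
        (h (X := p ^ 2 + q ^ 2 + t ^ 2) (le_add_self.trans le_self_add)))
        (h (X := p ^ 2 + q ^ 2 + t ^ 2) le_add_self)
    _ = _ := by ring

lemma nonlocalEnergy_eq (x₀ x₁ x₂ : ℝ) (f : ℝ → ℝ) :
    nonlocalEnergy x₀ x₁ x₂ f =
      screenedSeminorm (Ioo x₀ x₁) 1 f ^ 2 + screenedSeminorm (Ioi x₂) 1 f ^ 2 +
        ENNReal.ofReal |avgOn (Ioo x₀ x₁) f - avgOn (Ioo x₂ (x₂ + 2)) f| ^ 2 := by
  have h (X : ℝ≥0∞) : (X ^ (1 / 2 : ℝ)) ^ 2 = X := by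
    rw [← ENNReal.rpow_two, ← ENNReal.rpow_mul]; norm_num
  rw [screenedSeminorm_eq, screenedSeminorm_eq, h, h, ← ENNReal.ofReal_pow (abs_nonneg _), sq_abs]
  rfl

lemma Sseminorm_congr {x₀ x₁ x₂ : ℝ} {f g : ℝ → ℝ}
    (h : f =ᵐ[volume.restrict (Ioo x₀ x₁ ∪ Ioi x₂)] g) :
    Sseminorm x₀ x₁ x₂ f = Sseminorm x₀ x₁ x₂ g := by
  have h1 := ae_restrict_of_ae_restrict_of_subset (subset_union_left (s := Ioo x₀ x₁)) h
  have h2 := ae_restrict_of_ae_restrict_of_subset (subset_union_right (t := Ioi x₂)) h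
  have h3 := ae_restrict_of_ae_restrict_of_subset
    (Ioo_subset_Ioi_self : Ioo x₂ (x₂ + 2) ⊆ Ioi x₂) h2
  rw [Sseminorm, Sseminorm, screenedSeminorm_eq, screenedSeminorm_eq, screenedSeminorm_eq,
    screenedSeminorm_eq, screenedEnergy_congr h1, screenedEnergy_congr h2, avgOn_congr h1,
    avgOn_congr h3]

lemma LocIntOn.aemeasurable {I : Set ℝ} (hI : MeasurableSet I) {f : ℝ → ℝ} (hf : LocIntOn I f) :
    AEMeasurable f (volume.restrict I) := by
  have hU : I = ⋃ n : ℕ, I ∩ Metric.ball (0 : ℝ) n := by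
    rw [← inter_iUnion, Metric.iUnion_ball_nat, inter_univ]
  rw [hU, aemeasurable_iUnion_iff]
  exact fun n => (hf _ inter_subset_left (hI.inter measurableSet_ball)
    (Metric.isBounded_ball.subset inter_subset_right)).aemeasurable

lemma LocIntOn.congr {I : Set ℝ} {f g : ℝ → ℝ} (hf : LocIntOn I f)
    (h : f =ᵐ[volume.restrict I] g) : LocIntOn I g := fun s hs hsm hsb =>
  (hf s hs hsm hsb).congr (ae_restrict_of_ae_restrict_of_subset hs h)

lemma exists_Sseminorm_le_extensionInf {x₀ x₁ : ℝ} (x₂ : ℝ) (h01 : x₀ < x₁) :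
    ∃ C : ℝ≥0∞, C ≠ ⊤ ∧ ∀ f : ℝ → ℝ,
      Sseminorm x₀ x₁ x₂ f ≤ C * extensionInf x₀ x₁ x₂ f := by
  obtain ⟨C, hC, h⟩ := exists_nonlocalEnergy_le x₂ h01
  refine ⟨3 * C ^ (1 / 2 : ℝ) + 1, by finiteness, fun f => ?_⟩
  rw [mul_comm, ← ENNReal.div_le_iff (by simp) (by finiteness)]
  refine le_sInf ?_
  rintro _ ⟨g, hg, hgf, rfl⟩
  rw [ENNReal.div_le_iff (by simp) (by finiteness), mul_comm, ← Sseminorm_congr hgf]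
  have hm := hg.aemeasurable MeasurableSet.univ
  have hg' := hg.congr hm.ae_eq_mk
  have hsub : g =ᵐ[volume.restrict (Ioo x₀ x₁ ∪ Ioi x₂)] hm.mk g :=
    ae_restrict_of_ae_restrict_of_subset (subset_univ _) hm.ae_eq_mk
  rw [Sseminorm_congr hsub, screenedSeminorm_eq, screenedEnergy_congr hm.ae_eq_mk]
  calc Sseminorm x₀ x₁ x₂ (hm.mk g)
      ≤ 3 * nonlocalEnergy x₀ x₁ x₂ (hm.mk g) ^ (1 / 2 : ℝ) := by
        rw [nonlocalEnergy_eq]; exact add_le_three_mul_rpow_half _ _ _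
    _ ≤ 3 * (C * screenedEnergy univ 1 (hm.mk g)) ^ (1 / 2 : ℝ) := by
        gcongr; exact h _ hm.measurable_mk hg'
    _ = 3 * C ^ (1 / 2 : ℝ) * screenedEnergy univ 1 (hm.mk g) ^ (1 / 2 : ℝ) := by
        rw [ENNReal.mul_rpow_of_nonneg _ _ (by norm_num), mul_assoc]
    _ ≤ _ := by gcongr; exact le_self_add

lemma exists_extensionInf_le_Sseminorm {x₀ x₁ x₂ : ℝ} (h01 : x₀ < x₁) (h12 : x₁ < x₂) :
    ∃ C : ℝ≥0∞, C ≠ ⊤ ∧ ∀ f : ℝ → ℝ, LocIntOn (Ioo x₀ x₁ ∪ Ioi x₂) f →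
      Sseminorm x₀ x₁ x₂ f < ⊤ →
      extensionInf x₀ x₁ x₂ f ≤ C * Sseminorm x₀ x₁ x₂ f := by
  obtain ⟨C, hC, h⟩ := exists_extension h01 h12
  refine ⟨C ^ (1 / 2 : ℝ), by finiteness, fun f hf hS => ?_⟩
  have hm := hf.aemeasurable (measurableSet_Ioo.union measurableSet_Ioi)
  have hf' := hf.congr hm.ae_eq_mk
  rw [Sseminorm_congr hm.ae_eq_mk] at hS ⊢
  obtain ⟨g, hg, hgf, hgE⟩ := h _ hm.measurable_mk
    (hf' _ subset_union_left measurableSet_Ioo (Metric.isBounded_Ioo _ _))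
    (hf' _ (Ioo_subset_Ioi_self.trans subset_union_right) measurableSet_Ioo
      (Metric.isBounded_Ioo _ _))
  have hle : screenedSeminorm univ 1 g ≤
      C ^ (1 / 2 : ℝ) * Sseminorm x₀ x₁ x₂ (hm.mk f) :=
    calc screenedSeminorm univ 1 g
        ≤ (C * nonlocalEnergy x₀ x₁ x₂ (hm.mk f)) ^ (1 / 2 : ℝ) := by
          rw [screenedSeminorm_eq]; gcongr
      _ = C ^ (1 / 2 : ℝ) * nonlocalEnergy x₀ x₁ x₂ (hm.mk f) ^ (1 / 2 : ℝ) :=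
          ENNReal.mul_rpow_of_nonneg _ _ (by norm_num)
      _ ≤ _ := by
          gcongr
          rw [nonlocalEnergy_eq]
          exact rpow_half_sq_add_le _ _ _
  refine le_trans (b := screenedSeminorm univ 1 g) (sInf_le ⟨g, ?_, ?_, rfl⟩) hle
  · refine locIntOn_univ_of_screenedEnergy_lt_top hg one_pos ?_
    have := hle.trans_lt (ENNReal.mul_lt_top (by finiteness) hS)
    rwa [screenedSeminorm_eq, ENNReal.rpow_lt_top_iff_of_pos (by norm_num)] at this
  · filter_upwards [hm.ae_eq_mk,
      ae_restrict_mem (measurableSet_Ioo.union measurableSet_Ioi)] with x hx hxm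
    rw [hx, hgf x hxm]

/-- the space `Ḣ^{1/2}(E₁ ∪ E₂)` with the nonlocal seminorm `S` coincides,
with equivalent seminorms, with the space of restrictions of `Ḣ^{1/2}(ℝ)` functions:
there is `C > 0`, depending only on `x₀, x₁, x₂`, such that for every locally integrable
`f` on `E₁ ∪ E₂` with `S(f) < ∞`,
`C⁻¹ S(f) ≤ inf{|f̃|_{Ḣ^{1/2}(ℝ)} : f̃ = f a.e. on E₁ ∪ E₂} ≤ C S(f)`. -/
theorem statement13 (x₀ x₁ x₂ : ℝ) (h01 : x₀ < x₁) (h12 : x₁ < x₂) :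
    ∃ C : ℝ, 0 < C ∧ ∀ f : ℝ → ℝ,
      LocIntOn (Set.Ioo x₀ x₁ ∪ Set.Ioi x₂) f →
      Sseminorm x₀ x₁ x₂ f < ⊤ →
      ENNReal.ofReal C⁻¹ * Sseminorm x₀ x₁ x₂ f ≤ extensionInf x₀ x₁ x₂ f ∧
      extensionInf x₀ x₁ x₂ f ≤ ENNReal.ofReal C * Sseminorm x₀ x₁ x₂ f := by
  obtain ⟨A, hA, hlow⟩ := exists_Sseminorm_le_extensionInf x₂ h01
  obtain ⟨B, hB, hup⟩ := exists_extensionInf_le_Sseminorm h01 h12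
  have hpos : 0 < (A + B).toReal + 1 := by positivity
  have hAB : A + B ≤ ENNReal.ofReal ((A + B).toReal + 1) := by
    rw [ENNReal.le_ofReal_iff_toReal_le (by finiteness) hpos.le]
    linarith
  refine ⟨(A + B).toReal + 1, hpos, fun f hf hS => ⟨?_, ?_⟩⟩
  · rw [ENNReal.ofReal_inv_of_pos hpos, ← ENNReal.div_eq_inv_mul,
      ENNReal.div_le_iff (by simpa using hpos) ENNReal.ofReal_ne_top, mul_comm]
    refine (hlow f).trans ?_
    gcongr
    exact le_self_add.trans hAB
  · refine (hup f hf hS).trans ?_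
    gcongr
    exact le_add_self.trans hAB
end

section
/- There exists an absolute constant C > 0 such that for every measurable f : ℝ → ℝ, integrable on every bounded measurable subset of ℝ, and every x ≥ 0: | ∫₀ˣ f(t) dt | ≤ (x + 1) ∫₀¹ |f(t)| dt + C (1 + x)² |f|_{Ḣ^{1/2}(ℝ)}. In particular, if |f|_{Ḣ^{1/2}(ℝ)} < ∞ then the primitive F(x) = ∫₀ˣ f has at most quadratic growth, so f defines a tempered distribution. -/
open MeasureTheory Set Filter
open scoped ENNReal BigOperators

/-- Cauchy–Schwarz on a product of two half-unit intervals. -/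
theorem lintegral_lintegral_enorm_sub_le {f : ℝ → ℝ} (hf : AEMeasurable f) (a : ℝ) :
    ∫⁻ x in Ioc a (a + 1 / 2), ∫⁻ y in Ioc (a + 1 / 2) (a + 1), ‖f y - f x‖ₑ ≤
      screenedSeminorm Set.univ 1 f * ENNReal.ofReal (1 / 2) := by
  set μ := (volume : Measure ℝ).restrict (Ioc a (a + 1 / 2)) with hμ
  set ν := (volume : Measure ℝ).restrict (Ioc (a + 1 / 2) (a + 1)) with hν
  have hm : AEMeasurable (fun p : ℝ × ℝ => ‖f p.2 - f p.1‖ₑ) (μ.prod ν) :=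
    (hf.restrict.comp_snd.sub hf.restrict.comp_fst).enorm
  have hμu : μ univ = ENNReal.ofReal (1 / 2) := by
    rw [hμ, Measure.restrict_apply_univ, Real.volume_Ioc]; congr 1; ring
  have hνu : ν univ = ENNReal.ofReal (1 / 2) := by
    rw [hν, Measure.restrict_apply_univ, Real.volume_Ioc]; congr 1; ring
  have hsq : ∫⁻ p, ‖f p.2 - f p.1‖ₑ ^ (2 : ℝ) ∂(μ.prod ν) ≤
      ∫⁻ x in univ, ∫⁻ y in univ ∩ Set.Ioo (x - 1) (x + 1),
        ENNReal.ofReal ((f y - f x) ^ 2 / (y - x) ^ 2) := by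
    rw [lintegral_prod _ (hm.pow_const _)]
    refine le_trans ?_ (lintegral_mono_set (subset_univ (Ioc a (a + 1 / 2))))
    refine setLIntegral_mono' measurableSet_Ioc fun x hx => ?_
    have hsub : Ioc (a + 1 / 2) (a + 1) ⊆ univ ∩ Set.Ioo (x - 1) (x + 1) := fun y hy =>
      ⟨mem_univ _, by linarith [hx.2, hy.1], by linarith [hx.1, hy.2]⟩
    refine le_trans ?_ (lintegral_mono_set hsub)
    refine setLIntegral_mono' measurableSet_Ioc fun y hy => ?_
    have h0 : 0 < y - x := by linarith [hx.2, hy.1]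
    have h1 : y - x ≤ 1 := by linarith [hx.1, hy.2]
    dsimp only
    rw [Real.enorm_eq_ofReal_abs, ENNReal.ofReal_rpow_of_nonneg (abs_nonneg _) (by norm_num)]
    refine ENNReal.ofReal_le_ofReal ?_
    rw [Real.rpow_two, sq_abs, le_div_iff₀ (by positivity)]
    exact mul_le_of_le_one_right (sq_nonneg _) (pow_le_one₀ h0.le h1)
  have hone : (∫⁻ _ : ℝ × ℝ, (1 : ℝ≥0∞) ^ (2 : ℝ) ∂(μ.prod ν)) ^ (1 / 2 : ℝ) =
      ENNReal.ofReal (1 / 2) := by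
    rw [ENNReal.one_rpow, lintegral_one, ← univ_prod_univ, Measure.prod_prod, hμu, hνu, ← sq,
      ← ENNReal.rpow_two, ← ENNReal.rpow_mul]
    norm_num
  have hcs := ENNReal.lintegral_mul_le_Lp_mul_Lq (μ.prod ν) Real.HolderConjugate.two_two hm
    (aemeasurable_const (b := (1 : ℝ≥0∞)))
  rw [hone] at hcs
  simp only [Pi.mul_apply, mul_one] at hcs
  rw [lintegral_prod _ hm] at hcs
  refine hcs.trans ?_
  gcongr
  exact ENNReal.rpow_le_rpow hsq (by norm_num)

theorem lintegral_enorm_half_shift_le {f : ℝ → ℝ} (hf : AEMeasurable f) (a : ℝ) :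
    ∫⁻ y in Ioc (a + 1 / 2) (a + 1), ‖f y‖ₑ ≤
      (∫⁻ x in Ioc a (a + 1 / 2), ‖f x‖ₑ) + screenedSeminorm Set.univ 1 f := by
  have hvol₁ : volume (Ioc a (a + 1 / 2)) = ENNReal.ofReal (1 / 2) := by
    rw [Real.volume_Ioc]; congr 1; ring
  have hvol₂ : volume (Ioc (a + 1 / 2) (a + 1)) = ENNReal.ofReal (1 / 2) := by
    rw [Real.volume_Ioc]; congr 1; ring
  have h := calc
    (∫⁻ y in Ioc (a + 1 / 2) (a + 1), ‖f y‖ₑ) * ENNReal.ofReal (1 / 2)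
      = ∫⁻ _ in Ioc a (a + 1 / 2), ∫⁻ y in Ioc (a + 1 / 2) (a + 1), ‖f y‖ₑ := by
        rw [setLIntegral_const, hvol₁]
    _ ≤ ∫⁻ x in Ioc a (a + 1 / 2), (‖f x‖ₑ * ENNReal.ofReal (1 / 2) +
          ∫⁻ y in Ioc (a + 1 / 2) (a + 1), ‖f y - f x‖ₑ) := by
        refine lintegral_mono fun x => ?_
        rw [← hvol₂, ← setLIntegral_const, ← lintegral_add_left measurable_const]
        refine lintegral_mono fun y => ?_
        calc ‖f y‖ₑ = ‖f x + (f y - f x)‖ₑ := by rw [add_sub_cancel]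
          _ ≤ _ := enorm_add_le _ _
    _ = (∫⁻ x in Ioc a (a + 1 / 2), ‖f x‖ₑ) * ENNReal.ofReal (1 / 2) +
          ∫⁻ x in Ioc a (a + 1 / 2), ∫⁻ y in Ioc (a + 1 / 2) (a + 1), ‖f y - f x‖ₑ := by
        rw [lintegral_add_left' (hf.restrict.enorm.mul_const _),
          lintegral_mul_const'' _ hf.restrict.enorm]
    _ ≤ ((∫⁻ x in Ioc a (a + 1 / 2), ‖f x‖ₑ) + screenedSeminorm Set.univ 1 f) *
          ENNReal.ofReal (1 / 2) := by
        rw [add_mul]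
        gcongr
        exact lintegral_lintegral_enorm_sub_le hf a
  exact (ENNReal.mul_le_mul_iff_left (by simp) ENNReal.ofReal_ne_top).1 h

theorem setLIntegral_Ioc_add {g : ℝ → ℝ≥0∞} {a b c : ℝ} (hab : a ≤ b) (hbc : b ≤ c) :
    ∫⁻ x in Ioc a c, g x = (∫⁻ x in Ioc a b, g x) + ∫⁻ x in Ioc b c, g x := by
  rw [← Ioc_union_Ioc_eq_Ioc hab hbc,
    lintegral_union measurableSet_Ioc (Ioc_disjoint_Ioc_of_le le_rfl)]

theorem lintegral_enorm_unit_shift_le {f : ℝ → ℝ} (hf : AEMeasurable f) (a : ℝ) :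
    ∫⁻ y in Ioc (a + 1) (a + 2), ‖f y‖ₑ ≤
      (∫⁻ x in Ioc a (a + 1), ‖f x‖ₑ) + 4 * screenedSeminorm Set.univ 1 f := by
  have h₁ := lintegral_enorm_half_shift_le hf a
  have h₂ := lintegral_enorm_half_shift_le hf (a + 1 / 2)
  have h₃ := lintegral_enorm_half_shift_le hf (a + 1)
  rw [show a + 1 / 2 + 1 / 2 = a + 1 by ring, show a + 1 / 2 + 1 = a + 1 + 1 / 2 by ring] at h₂
  rw [show a + 1 + 1 = a + 2 by ring] at h₃
  rw [setLIntegral_Ioc_add (a := a) (b := a + 1 / 2) (c := a + 1) (by linarith) (by linarith),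
    setLIntegral_Ioc_add (a := a + 1) (b := a + 1 + 1 / 2) (c := a + 2)
      (by linarith) (by linarith)]
  set S := screenedSeminorm Set.univ 1 f
  set p := ∫⁻ x in Ioc a (a + 1 / 2), ‖f x‖ₑ
  set q := ∫⁻ x in Ioc (a + 1 / 2) (a + 1), ‖f x‖ₑ
  set r := ∫⁻ x in Ioc (a + 1) (a + 1 + 1 / 2), ‖f x‖ₑ
  calc _ ≤ (q + S) + (r + S) := by gcongr
    _ ≤ ((p + S) + S) + ((q + S) + S) := by gcongr
    _ = p + q + 4 * S := by ring

theorem lintegral_enorm_unit_le {f : ℝ → ℝ} (hf : AEMeasurable f) (n : ℕ) :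
    ∫⁻ y in Ioc (n : ℝ) (n + 1), ‖f y‖ₑ ≤
      (∫⁻ x in Ioc (0 : ℝ) 1, ‖f x‖ₑ) + 4 * n * screenedSeminorm Set.univ 1 f := by
  induction n with
  | zero => simp
  | succ n ih =>
    have h := lintegral_enorm_unit_shift_le hf n
    push_cast
    rw [show (n : ℝ) + 1 + 1 = n + 2 by ring]
    refine h.trans ((add_le_add_left ih _).trans_eq ?_)
    ring

theorem lintegral_enorm_Ioc_natCast_le {f : ℝ → ℝ} (hf : AEMeasurable f) (n : ℕ) :
    ∫⁻ y in Ioc (0 : ℝ) n, ‖f y‖ₑ ≤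
      n * (∫⁻ x in Ioc (0 : ℝ) 1, ‖f x‖ₑ) + 4 * n ^ 2 * screenedSeminorm Set.univ 1 f := by
  induction n with
  | zero => simp
  | succ n ih =>
    push_cast
    rw [setLIntegral_Ioc_add (b := (n : ℝ)) (by positivity) (by linarith)]
    refine (add_le_add ih (lintegral_enorm_unit_le hf n)).trans ?_
    set A := ∫⁻ x in Ioc (0 : ℝ) 1, ‖f x‖ₑ
    set S := screenedSeminorm Set.univ 1 f
    calc _ ≤ _ + (4 * n * S + 4 * S) := le_self_add
      _ = _ := by ring

/-- polynomial growth of the primitive. There is an absolute constant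
`C > 0` such that for every locally integrable `f : ℝ → ℝ` and every `x ≥ 0`,
`|∫₀ˣ f| ≤ (x + 1) ∫₀¹ |f| + C (1 + x)² |f|_{Ḣ^{1/2}(ℝ)}`; hence if the screened
seminorm is finite the primitive of `f` has at most quadratic growth. -/
theorem statement14 :
    ∃ C : ℝ, 0 < C ∧ ∀ f : ℝ → ℝ, LocIntOn Set.univ f → ∀ x : ℝ, 0 ≤ x →
      ENNReal.ofReal |∫ t in (0 : ℝ)..x, f t| ≤
        ENNReal.ofReal ((x + 1) * ∫ t in (0 : ℝ)..1, |f t|) +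
          ENNReal.ofReal (C * (1 + x) ^ 2) * screenedSeminorm Set.univ 1 f := by
  refine ⟨4, by norm_num, fun f hf x hx => ?_⟩
  have hmeas : AEMeasurable f := by
    have h : LocallyIntegrable f := (locallyIntegrable_iff).2 fun k hk =>
      hf k (subset_univ _) hk.measurableSet hk.isBounded
    exact h.aestronglyMeasurable.aemeasurable
  have hint : IntegrableOn f (Ioc 0 1) :=
    hf _ (subset_univ _) measurableSet_Ioc (Metric.isBounded_Ioc 0 1)
  set n := ⌊x⌋₊ + 1 with hn
  have hxn : x ≤ n := by
    rw [hn]; push_cast; exact (Nat.lt_floor_add_one x).le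
  have hnx : (n : ℝ) ≤ x + 1 := by
    rw [hn]; push_cast; linarith [Nat.floor_le hx]
  have hnx' : (n : ℝ≥0∞) ≤ ENNReal.ofReal (x + 1) := by
    rw [← ENNReal.ofReal_natCast]
    exact ENNReal.ofReal_le_ofReal hnx
  have hA : ENNReal.ofReal (∫ t in (0 : ℝ)..1, |f t|) = ∫⁻ t in Ioc (0 : ℝ) 1, ‖f t‖ₑ := by
    rw [intervalIntegral.integral_of_le zero_le_one]
    exact ofReal_integral_norm_eq_lintegral_enorm hint
  rw [ENNReal.ofReal_mul (by positivity), hA, ENNReal.ofReal_mul (by norm_num),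
    ENNReal.ofReal_pow (by positivity), add_comm 1 x, ENNReal.ofReal_ofNat,
    ← Real.enorm_eq_ofReal_abs, intervalIntegral.integral_of_le hx]
  calc ‖∫ t in Ioc 0 x, f t‖ₑ ≤ ∫⁻ t in Ioc 0 x, ‖f t‖ₑ := enorm_integral_le_lintegral_enorm _
    _ ≤ ∫⁻ t in Ioc (0 : ℝ) n, ‖f t‖ₑ := lintegral_mono_set (Ioc_subset_Ioc_right hxn)
    _ ≤ n * (∫⁻ t in Ioc (0 : ℝ) 1, ‖f t‖ₑ) + 4 * n ^ 2 * screenedSeminorm Set.univ 1 f :=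
        lintegral_enorm_Ioc_natCast_le hmeas n
    _ ≤ _ := by gcongr
end

section
/- For every measurable f : ℝ → ℝ, integrable on every bounded measurable subset of ℝ, with |f|_{Ḣ^{1/2}(ℝ)} < ∞, and for every ε > 0, there exists an infinitely differentiable function φ : ℝ → ℝ with compact support such that |f − φ|_{Ḣ^{1/2}(ℝ)} ≤ ε. That is, C_c^∞(ℝ) is dense in Ḣ^{1/2}(ℝ) for the screened seminorm. -/
open MeasureTheory Set Filter
open scoped ENNReal BigOperators

/-- The kernel `z⁻¹` restricted to `|z| < 1`. -/
noncomputable def screenWeight (z : ℝ) : ℝ := (Ioo (-1 : ℝ) 1).indicator (fun z => z⁻¹) z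

/-- The function on the plane whose `L²` norm is the screened seminorm of `f`. -/
noncomputable def screenedQuotient (f : ℝ → ℝ) (p : ℝ × ℝ) : ℝ :=
  screenWeight (p.2 - p.1) * (f p.2 - f p.1)

lemma measurable_screenWeight : Measurable screenWeight :=
  measurable_inv.indicator measurableSet_Ioo

lemma measurable_screenedQuotient {f : ℝ → ℝ} (hf : Measurable f) :
    Measurable (screenedQuotient f) :=
  (measurable_screenWeight.comp (measurable_snd.sub measurable_fst)).mul
    ((hf.comp measurable_snd).sub (hf.comp measurable_fst))

lemma screenedQuotient_ae_eq {f g : ℝ → ℝ} (h : f =ᵐ[volume] g) :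
    screenedQuotient f =ᵐ[volume] screenedQuotient g := by
  have h1 : ∀ᵐ p : ℝ × ℝ, f p.1 = g p.1 := Measure.quasiMeasurePreserving_fst.ae h
  have h2 : ∀ᵐ p : ℝ × ℝ, f p.2 = g p.2 := Measure.quasiMeasurePreserving_snd.ae h
  filter_upwards [h1, h2] with p hp1 hp2
  simp [screenedQuotient, hp1, hp2]

lemma aemeasurable_screenedQuotient {f : ℝ → ℝ} (hf : AEMeasurable f) :
    AEMeasurable (screenedQuotient f) :=
  ⟨_, measurable_screenedQuotient hf.measurable_mk, screenedQuotient_ae_eq hf.ae_eq_mk⟩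

lemma eLpNorm_two_sq {α : Type*} [MeasurableSpace α] (μ : Measure α) (u : α → ℝ) :
    eLpNorm u 2 μ ^ 2 = ∫⁻ x, ‖u x‖ₑ ^ 2 ∂μ := by
  rw [eLpNorm_eq_lintegral_rpow_enorm_toReal (by norm_num) (by norm_num), ← ENNReal.rpow_natCast,
    ← ENNReal.rpow_mul]
  simp

lemma screenedSeminorm_eq_eLpNorm {f : ℝ → ℝ} (hf : AEMeasurable f) :
    screenedSeminorm univ 1 f = eLpNorm (screenedQuotient f) 2 volume := by
  rw [eLpNorm_eq_lintegral_rpow_enorm_toReal (by norm_num) (by norm_num), screenedSeminorm,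
    Measure.volume_eq_prod,
    lintegral_prod _ ((aemeasurable_screenedQuotient hf).enorm.pow_const _)]
  simp only [univ_inter, Measure.restrict_univ, ENNReal.toReal_ofNat]
  congr 1
  refine lintegral_congr fun x => ?_
  rw [← lintegral_indicator measurableSet_Ioo]
  refine lintegral_congr fun y => ?_
  by_cases hy : y ∈ Ioo (x - 1) (x + 1)
  · have : y - x ∈ Ioo (-1 : ℝ) 1 := ⟨by linarith [hy.1], by linarith [hy.2]⟩
    rw [indicator_of_mem hy, screenedQuotient, screenWeight, indicator_of_mem this,
      Real.enorm_eq_ofReal_abs, ENNReal.ofReal_rpow_of_nonneg (abs_nonneg _) (by norm_num)]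
    congr 1
    rw [Real.rpow_ofNat, sq_abs]
    simp only [div_eq_mul_inv]
    rw [mul_pow, inv_pow]
    ring
  · have : y - x ∉ Ioo (-1 : ℝ) 1 := fun h => hy ⟨by linarith [h.1], by linarith [h.2]⟩
    rw [indicator_of_notMem hy, screenedQuotient, screenWeight, indicator_of_notMem this]
    simp

lemma lintegral_mul_sq_le {α : Type*} [MeasurableSpace α] {μ : Measure α} {r u : α → ℝ≥0∞}
    (hr : Measurable r) (hu : Measurable u) :
    (∫⁻ t, r t * u t ∂μ) ^ 2 ≤ (∫⁻ t, r t ∂μ) * ∫⁻ t, r t * u t ^ 2 ∂μ := by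
  have hs : ∀ a : ℝ≥0∞, a ^ (1 / 2 : ℝ) * a ^ (1 / 2 : ℝ) = a := fun a => by
    rw [← ENNReal.rpow_add_of_nonneg _ _ (by norm_num) (by norm_num)]; norm_num
  have hs' : ∀ a : ℝ≥0∞, (a ^ (1 / 2 : ℝ)) ^ 2 = a := fun a => by rw [sq, hs]
  have h := ENNReal.lintegral_mul_le_Lp_mul_Lq μ (p := 2) (q := 2) .two_two
    (f := fun t => r t ^ (1 / 2 : ℝ)) (g := fun t => r t ^ (1 / 2 : ℝ) * u t)
    (hr.pow_const _).aemeasurable ((hr.pow_const _).mul hu).aemeasurable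
  simp only [Pi.mul_apply, ← mul_assoc, hs, ENNReal.rpow_ofNat, mul_pow, hs'] at h
  calc _ ≤ _ := pow_le_pow_left₀ (zero_le) h 2
    _ = _ := by rw [mul_pow, hs', hs']

lemma enorm_integral_mul_sq_le {α : Type*} [MeasurableSpace α] {μ : Measure α} {r u : α → ℝ}
    (hr : Measurable r) (hu : Measurable u) :
    ‖∫ t, r t * u t ∂μ‖ₑ ^ 2 ≤ (∫⁻ t, ‖r t‖ₑ ∂μ) * ∫⁻ t, ‖r t‖ₑ * ‖u t‖ₑ ^ 2 ∂μ := by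
  refine le_trans (pow_le_pow_left₀ zero_le (enorm_integral_le_lintegral_enorm _) 2) ?_
  simp only [enorm_mul]
  exact lintegral_mul_sq_le hr.enorm hu.enorm

lemma eLpNorm_screenedQuotient_le {G G' : ℝ → ℝ} (hG : ∀ x, HasDerivAt G (G' x) x)
    (hG' : Continuous G') :
    eLpNorm (screenedQuotient G) 2 volume ≤ 2 * eLpNorm G' 2 volume := by
  have hGc : Continuous G := continuous_iff_continuousAt.2 fun x => (hG x).continuousAt
  have hm' : Measurable G' := hG'.measurable
  refine (ENNReal.pow_right_strictMono two_ne_zero).le_iff_le.1 ?_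
  rw [mul_pow, eLpNorm_two_sq,
    eLpNorm_two_sq, Measure.volume_eq_prod,
    lintegral_prod _ ((measurable_screenedQuotient hGc.measurable).enorm.pow_const _).aemeasurable]
  have key : ∀ x z, ‖screenedQuotient G (x, x + z)‖ₑ ^ 2 ≤
      (Ioo (-1 : ℝ) 1).indicator 1 z * ∫⁻ s in Icc (0 : ℝ) 1, ‖G' (x + s * z)‖ₑ ^ 2 := by
    intro x z
    by_cases hz : z ∈ Ioo (-1 : ℝ) 1
    · rw [indicator_of_mem hz, Pi.one_apply, one_mul]
      have hftc := intervalIntegral.integral_unitInterval_deriv_eq_sub (f := G) (f' := G')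
        (z₀ := x) (z₁ := z) (by fun_prop) (fun t _ => hG _)
      have hq : ‖screenedQuotient G (x, x + z)‖ₑ ≤
          ‖∫ s in Icc (0 : ℝ) 1, 1 * G' (x + s * z)‖ₑ := by
        rw [screenedQuotient, screenWeight]
        simp only [add_sub_cancel_left]
        rw [indicator_of_mem hz, ← hftc, intervalIntegral.integral_of_le zero_le_one,
          ← integral_Icc_eq_integral_Ioc]
        simp only [smul_eq_mul, one_mul]
        rcases eq_or_ne z 0 with rfl | h0
        · simp
        · rw [inv_mul_cancel_left₀ h0]
      calc _ ≤ _ := pow_le_pow_left₀ zero_le hq 2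
        _ ≤ _ := enorm_integral_mul_sq_le measurable_const (by fun_prop)
        _ = _ := by simp
    · have : screenWeight z = 0 := indicator_of_notMem hz _
      simp [screenedQuotient, this]
  calc ∫⁻ x, ∫⁻ y, ‖screenedQuotient G (x, y)‖ₑ ^ 2
      = ∫⁻ x, ∫⁻ z, ‖screenedQuotient G (x, x + z)‖ₑ ^ 2 := lintegral_congr fun x =>
        (lintegral_add_left_eq_self (fun y => ‖screenedQuotient G (x, y)‖ₑ ^ 2) x).symm
    _ ≤ ∫⁻ x, ∫⁻ z, (Ioo (-1 : ℝ) 1).indicator 1 z *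
          ∫⁻ s in Icc (0 : ℝ) 1, ‖G' (x + s * z)‖ₑ ^ 2 :=
        lintegral_mono fun x => lintegral_mono fun z => key x z
    _ = ∫⁻ z, ∫⁻ x, (Ioo (-1 : ℝ) 1).indicator 1 z *
          ∫⁻ s in Icc (0 : ℝ) 1, ‖G' (x + s * z)‖ₑ ^ 2 := by
        refine lintegral_lintegral_swap (Measurable.aemeasurable ?_)
        refine Measurable.mul ?_ ?_
        · exact (measurable_one.indicator measurableSet_Ioo).comp measurable_snd
        · exact Measurable.lintegral_prod_right'
            (f := fun q : (ℝ × ℝ) × ℝ => ‖G' (q.1.1 + q.2 * q.1.2)‖ₑ ^ 2) (by fun_prop)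
    _ = ∫⁻ z, (Ioo (-1 : ℝ) 1).indicator 1 z * ∫⁻ x, ‖G' x‖ₑ ^ 2 := by
        refine lintegral_congr fun z => ?_
        rw [lintegral_const_mul _ (Measurable.lintegral_prod_right'
            (f := fun q : ℝ × ℝ => ‖G' (q.1 + q.2 * z)‖ₑ ^ 2) (by fun_prop))]
        congr 1
        rw [lintegral_lintegral_swap (Measurable.aemeasurable (by unfold Function.uncurry; fun_prop))]
        simp [lintegral_add_right_eq_self (fun x => ‖G' x‖ₑ ^ 2)]
    _ = 2 * ∫⁻ x, ‖G' x‖ₑ ^ 2 := by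
        rw [lintegral_mul_const _ (measurable_one.indicator measurableSet_Ioo),
          lintegral_indicator_one measurableSet_Ioo, Real.volume_Ioo]
        norm_num
    _ ≤ _ := by gcongr; norm_num

lemma exists_translation_lt {F : ℝ × ℝ → ℝ} (hF : MemLp F 2 volume) {ε : ℝ≥0∞} (hε : 0 < ε) :
    ∃ δ > 0, ∀ t : ℝ, |t| < δ → eLpNorm (fun p => F ((-t, -t) + p) - F p) 2 volume < ε := by
  have : Fact ((2 : ℝ≥0∞) ≠ ∞) := ⟨by norm_num⟩
  have : Fact ((1 : ℝ≥0∞) ≤ 2) := ⟨by norm_num⟩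
  have hc : Continuous fun t : ℝ => DomAddAct.mk ((-t, -t) : ℝ × ℝ) +ᵥ hF.toLp F := by
    have : Continuous fun t : ℝ => DomAddAct.mk ((-t, -t) : ℝ × ℝ) :=
      DomAddAct.continuous_mk.comp (by fun_prop)
    exact this.vadd continuous_const
  have h0 := hc.tendsto 0
  have hm : ∀ t : ℝ, MemLp (fun p => F ((-t, -t) + p)) 2 volume := fun t =>
    hF.comp_measurePreserving (measurePreserving_add_left volume ((-t, -t) : ℝ × ℝ))
  have e : ∀ t : ℝ, DomAddAct.mk ((-t, -t) : ℝ × ℝ) +ᵥ hF.toLp F = (hm t).toLp _ := fun t =>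
    DomAddAct.mk_vadd_toLp _ hF
  simp only [e] at h0
  rw [Lp.tendsto_Lp_iff_tendsto_eLpNorm''] at h0
  have := h0.eventually (gt_mem_nhds hε)
  rw [Metric.eventually_nhds_iff] at this
  obtain ⟨δ, hδ, h⟩ := this
  refine ⟨δ, hδ, fun t ht => ?_⟩
  have := h (y := t) (by simpa using ht)
  simpa [Pi.sub_def, ← Prod.zero_eq_mk] using this

lemma screenedQuotient_sub (f g : ℝ → ℝ) :
    screenedQuotient (fun x => f x - g x) = screenedQuotient f - screenedQuotient g := by
  ext p
  simp only [screenedQuotient, Pi.sub_apply]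
  ring

lemma integrable_mul_comp_sub {f r : ℝ → ℝ} (hf : LocallyIntegrable f) (hr : Continuous r)
    (hrc : HasCompactSupport r) (x : ℝ) : Integrable (fun t => r t * f (x - t)) := by
  have h := hf.integrable_smul_left_of_hasCompactSupport (g := fun t => r (x - t)) (by fun_prop)
    (hrc.comp_homeomorph (Homeomorph.subLeft x))
  simpa using h.comp_sub_left x

lemma eLpNorm_screenedQuotient_sub_average_le {f r : ℝ → ℝ} (hf : Measurable f)
    (hfi : LocallyIntegrable f) (hr : Continuous r) (hrc : HasCompactSupport r)
    (hr0 : ∀ t, 0 ≤ r t) (hr1 : ∫ t, r t = 1) {δ : ℝ} (hrδ : ∀ t, r t ≠ 0 → |t| < δ) {ε : ℝ≥0∞}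
    (hε : ∀ t : ℝ, |t| < δ → eLpNorm (fun p => screenedQuotient f ((-t, -t) + p) -
      screenedQuotient f p) 2 volume ≤ ε) :
    eLpNorm (screenedQuotient fun x => f x - ∫ t, r t * f (x - t)) 2 volume ≤ ε := by
  have hm := measurable_screenedQuotient hf
  have hri : Integrable r := hr.integrable_of_hasCompactSupport hrc
  have hnorm : ∫⁻ t, ‖r t‖ₑ = 1 := by
    rw [← ofReal_integral_norm_eq_lintegral_enorm hri]
    simp [abs_of_nonneg (hr0 _), hr1]
  have hpt : ∀ p, screenedQuotient (fun x => f x - ∫ t, r t * f (x - t)) p =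
      -∫ t, r t * (screenedQuotient f ((-t, -t) + p) - screenedQuotient f p) := by
    intro p
    have h1 := integrable_mul_comp_sub hfi hr hrc p.1
    have h2 := integrable_mul_comp_sub hfi hr hrc p.2
    have e : ∀ t, r t * (screenedQuotient f ((-t, -t) + p) - screenedQuotient f p) =
        screenWeight (p.2 - p.1) * ((r t * f (p.2 - t) - r t * f (p.1 - t)) -
          r t * (f p.2 - f p.1)) := by
      intro t
      simp only [screenedQuotient, Prod.fst_add, Prod.snd_add, neg_add_eq_sub,
        sub_sub_sub_cancel_right]
      ring
    have hint : ∫ t, (r t * f (p.2 - t) - r t * f (p.1 - t) - r t * (f p.2 - f p.1)) =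
        (∫ t, r t * f (p.2 - t)) - (∫ t, r t * f (p.1 - t)) - (f p.2 - f p.1) := by
      rw [integral_sub (f := fun t => r t * f (p.2 - t) - r t * f (p.1 - t)) (h2.sub h1)
        (hri.mul_const _), integral_sub h2 h1, integral_mul_const, hr1, one_mul]
    simp_rw [e]
    rw [integral_const_mul, hint, screenedQuotient]
    ring
  refine (ENNReal.pow_right_strictMono two_ne_zero).le_iff_le.1 ?_
  rw [eLpNorm_two_sq]
  have hu : Measurable fun q : (ℝ × ℝ) × ℝ =>
      screenedQuotient f ((-q.2, -q.2) + q.1) - screenedQuotient f q.1 :=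
    (hm.comp (by fun_prop)).sub (hm.comp measurable_fst)
  have hru : Measurable fun q : (ℝ × ℝ) × ℝ => ‖r q.2‖ₑ *
      ‖screenedQuotient f ((-q.2, -q.2) + q.1) - screenedQuotient f q.1‖ₑ ^ 2 :=
    (hr.measurable.enorm.comp measurable_snd).mul (hu.enorm.pow_const 2)
  calc ∫⁻ p, ‖screenedQuotient (fun x => f x - ∫ t, r t * f (x - t)) p‖ₑ ^ 2
      ≤ ∫⁻ p, ∫⁻ t, ‖r t‖ₑ *
          ‖screenedQuotient f ((-t, -t) + p) - screenedQuotient f p‖ₑ ^ 2 := by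
        refine lintegral_mono fun p => ?_
        rw [hpt, enorm_neg]
        refine (enorm_integral_mul_sq_le hr.measurable (hu.comp measurable_prodMk_left)).trans ?_
        rw [hnorm, one_mul]
        rfl
    _ = ∫⁻ t, ∫⁻ p, ‖r t‖ₑ *
          ‖screenedQuotient f ((-t, -t) + p) - screenedQuotient f p‖ₑ ^ 2 :=
        lintegral_lintegral_swap hru.aemeasurable
    _ ≤ ∫⁻ t, ‖r t‖ₑ * ε ^ 2 := by
        refine lintegral_mono fun t => ?_
        rw [lintegral_const_mul' _ _ enorm_ne_top, ← eLpNorm_two_sq]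
        by_cases h0 : r t = 0
        · simp [h0]
        · gcongr
          exact hε t (hrδ t h0)
    _ = ε ^ 2 := by rw [lintegral_mul_const _ hr.measurable.enorm, hnorm, one_mul]

lemma eLpNorm_average_lt_top_of_integral_eq_zero {f r : ℝ → ℝ} (hf : Measurable f)
    (hfi : LocallyIntegrable f) (hr : Continuous r) (hrc : HasCompactSupport r)
    (hr0 : ∫ t, r t = 0) (hr1 : ∀ t, r t ≠ 0 → |t| < 1)
    (hK : MemLp (screenedQuotient f) 2 volume) :
    eLpNorm (fun x => ∫ t, r t * f (x - t)) 2 volume < ∞ := by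
  have hri : Integrable r := hr.integrable_of_hasCompactSupport hrc
  obtain ⟨M, hM⟩ := hrc.exists_bound_of_continuous hr
  have hpt : ∀ x, ∫ t, r t * f (x - t) = ∫ t, r t * (f (x - t) - f x) := by
    intro x
    simp_rw [mul_sub]
    rw [integral_sub (integrable_mul_comp_sub hfi hr hrc x) (hri.mul_const _),
      integral_mul_const, hr0]
    ring
  have hbd : ∀ x t, ‖r t‖ₑ * ‖f (x - t) - f x‖ₑ ^ 2 ≤
      ENNReal.ofReal M * ‖screenedQuotient f (x, x - t)‖ₑ ^ 2 := by
    intro x t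
    by_cases h0 : r t = 0
    · simp [h0]
    have ht := abs_lt.1 (hr1 t h0)
    have hle : ‖r t‖ₑ ≤ ENNReal.ofReal M := by
      rw [← ofReal_norm]
      exact ENNReal.ofReal_le_ofReal (hM t)
    gcongr
    rw [← ofReal_norm, ← ofReal_norm]
    refine ENNReal.ofReal_le_ofReal ?_
    rw [screenedQuotient, screenWeight]
    simp only [sub_sub_cancel_left]
    rw [indicator_of_mem (show -t ∈ Ioo (-1 : ℝ) 1 from ⟨by linarith, by linarith⟩), norm_mul]
    rcases eq_or_ne t 0 with rfl | h0
    · simp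
    · refine le_mul_of_one_le_left (norm_nonneg _) ?_
      rw [norm_inv, norm_neg, Real.norm_eq_abs]
      exact (one_le_inv₀ (abs_pos.2 h0)).2 (abs_lt.2 ht).le
  have hfin : (∫⁻ t, ‖r t‖ₑ) * (ENNReal.ofReal M * eLpNorm (screenedQuotient f) 2 volume ^ 2) < ∞ :=
    ENNReal.mul_lt_top hri.2 (ENNReal.mul_lt_top ENNReal.ofReal_lt_top (ENNReal.pow_lt_top hK.2))
  have hsq : eLpNorm (fun x => ∫ t, r t * f (x - t)) 2 volume ^ 2 < ∞ := by
    refine lt_of_le_of_lt ?_ hfin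
    rw [eLpNorm_two_sq, eLpNorm_two_sq, Measure.volume_eq_prod,
      lintegral_prod _ ((measurable_screenedQuotient hf).enorm.pow_const _).aemeasurable,
      ← lintegral_const_mul' _ _ ENNReal.ofReal_ne_top, ← lintegral_const_mul' _ _ hri.2.ne]
    refine lintegral_mono fun x => ?_
    rw [hpt]
    refine (enorm_integral_mul_sq_le hr.measurable (by fun_prop)).trans ?_
    gcongr
    rw [← lintegral_sub_left_eq_self (fun y => ‖screenedQuotient f (x, y)‖ₑ ^ 2) x, ← lintegral_const_mul' _ _ ENNReal.ofReal_ne_top]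
    exact lintegral_mono (hbd x)
  exact (ENNReal.pow_lt_top_iff.1 hsq).resolve_right (by norm_num)

lemma exists_contDiff_hasCompactSupport_eLpNorm_sub_lt {h : ℝ → ℝ} (hh : ContDiff ℝ (⊤ : ℕ∞) h)
    (hL : eLpNorm h 2 volume < ∞) {ε : ℝ≥0∞} (hε : 0 < ε) :
    ∃ ψ : ℝ → ℝ, ContDiff ℝ (⊤ : ℕ∞) ψ ∧ HasCompactSupport ψ ∧
      eLpNorm (fun x => h x - ψ x) 2 volume < ε := by
  let b : ℕ → ContDiffBump (0 : ℝ) := fun n =>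
    ⟨(n : ℝ) + 1, (n : ℝ) + 2, by positivity, by linarith⟩
  have hsq : ∫⁻ x, ‖h x‖ₑ ^ 2 ≠ ∞ := by
    rw [← eLpNorm_two_sq]
    exact (ENNReal.pow_lt_top hL).ne
  have hlim : Tendsto (fun n => ∫⁻ x, ‖h x - b n x * h x‖ₑ ^ 2) atTop (nhds (∫⁻ _ : ℝ, 0)) := by
    refine tendsto_lintegral_of_dominated_convergence (fun x => ‖h x‖ₑ ^ 2) (fun n => ?_)
      (fun n => Eventually.of_forall fun x => ?_) hsq (Eventually.of_forall fun x => ?_)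
    · have := (b n).continuous
      have := hh.continuous
      fun_prop
    · refine pow_le_pow_left₀ zero_le ?_ 2
      rw [← one_sub_mul, enorm_mul]
      refine mul_le_of_le_one_left zero_le ?_
      rw [← ofReal_norm, ENNReal.ofReal_le_one, Real.norm_eq_abs, abs_le]
      exact ⟨by linarith [(b n).le_one (x := x)], by linarith [(b n).nonneg (x := x)]⟩
    · refine tendsto_const_nhds.congr' ?_
      filter_upwards [eventually_ge_atTop ⌈|x|⌉₊] with n hn
      have hx : |x| ≤ n := (Nat.le_ceil _).trans (by exact_mod_cast hn)
      have : b n x = 1 := (b n).one_of_mem_closedBall (by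
        rw [mem_closedBall_zero_iff, Real.norm_eq_abs]
        change |x| ≤ n + 1
        linarith)
      simp [this]
  rw [lintegral_zero] at hlim
  obtain ⟨n, hn⟩ := (hlim.eventually (gt_mem_nhds (ENNReal.pow_pos hε 2))).exists
  refine ⟨fun x => b n x * h x, (b n).contDiff.mul hh, (b n).hasCompactSupport.mul_right, ?_⟩
  rw [← eLpNorm_two_sq] at hn
  exact (ENNReal.pow_right_strictMono two_ne_zero).lt_iff_lt.1 hn

lemma exists_contDiff_integral_eq_eLpNorm_lt (m : ℝ) {ε : ℝ≥0∞} (hε : 0 < ε) :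
    ∃ η : ℝ → ℝ, ContDiff ℝ (⊤ : ℕ∞) η ∧ HasCompactSupport η ∧ ∫ x, η x = m ∧
      eLpNorm η 2 volume < ε := by
  let b : ℕ → ContDiffBump (0 : ℝ) := fun n =>
    ⟨(n : ℝ) + 1, (n : ℝ) + 2, by positivity, by linarith⟩
  have hbd : ∀ n, eLpNorm (fun x => m * (b n).normed volume x) 2 volume ^ 2 ≤
      ENNReal.ofReal (m ^ 2 * (1 / ((n : ℝ) + 1))) := by
    intro n
    have hle : ∀ x, (b n).normed volume x ≤ 1 / ((n : ℝ) + 1) := fun x => by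
      refine ((b n).normed_le_div_measure_closedBall_rIn volume x).trans ?_
      rw [Real.volume_real_closedBall (b n).rIn_pos.le]
      change 1 / (2 * ((n : ℝ) + 1)) ≤ _
      exact one_div_le_one_div_of_le (by positivity) (by linarith [n.cast_nonneg (α := ℝ)])
    rw [eLpNorm_two_sq]
    calc ∫⁻ x, ‖m * (b n).normed volume x‖ₑ ^ 2
        ≤ ∫⁻ x, ENNReal.ofReal (m ^ 2 * (1 / ((n : ℝ) + 1)) * (b n).normed volume x) := by
          refine lintegral_mono fun x => ?_
          rw [← ofReal_norm, ← ENNReal.ofReal_pow (norm_nonneg _), Real.norm_eq_abs, sq_abs]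
          refine ENNReal.ofReal_le_ofReal ?_
          have := mul_le_mul_of_nonneg_right (hle x) ((b n).nonneg_normed (μ := volume) x)
          nlinarith [mul_le_mul_of_nonneg_left this (sq_nonneg m)]
      _ = _ := by
          rw [← ofReal_integral_eq_lintegral_ofReal ((b n).integrable_normed.const_mul _)
            (Eventually.of_forall fun x => mul_nonneg (by positivity) ((b n).nonneg_normed x)),
            integral_const_mul, (b n).integral_normed, mul_one]
  have hlim : Tendsto (fun n : ℕ => ENNReal.ofReal (m ^ 2 * (1 / ((n : ℝ) + 1)))) atTop (nhds 0) := by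
    have := ENNReal.tendsto_ofReal (tendsto_one_div_add_atTop_nhds_zero_nat.const_mul (m ^ 2))
    simpa using this
  obtain ⟨n, hn⟩ := (hlim.eventually (gt_mem_nhds (ENNReal.pow_pos hε 2))).exists
  refine ⟨fun x => m * (b n).normed volume x, contDiff_const.mul (b n).contDiff_normed,
    (b n).hasCompactSupport_normed.mul_left, ?_, ?_⟩
  · rw [integral_const_mul, (b n).integral_normed, mul_one]
  · exact (ENNReal.pow_right_strictMono two_ne_zero).lt_iff_lt.1 ((hbd n).trans_lt hn)

lemma exists_hasCompactSupport_primitive {θ : ℝ → ℝ} (hθ : ContDiff ℝ (⊤ : ℕ∞) θ)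
    (hc : HasCompactSupport θ) (h0 : ∫ x, θ x = 0) :
    ∃ φ : ℝ → ℝ, ContDiff ℝ (⊤ : ℕ∞) φ ∧ HasCompactSupport φ ∧ ∀ x, HasDerivAt φ (θ x) x := by
  obtain ⟨R, hR⟩ := hc.isCompact.isBounded.subset_closedBall 0
  have hz : ∀ x, R < |x| → θ x = 0 := fun x hx => by
    by_contra hne
    have := hR (subset_tsupport _ hne)
    rw [mem_closedBall_zero_iff, Real.norm_eq_abs] at this
    linarith
  have hd : ∀ x, HasDerivAt (fun u => ∫ t in (-R)..u, θ t) (θ x) x := fun x =>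
    hθ.continuous.integral_hasStrictDerivAt (-R) x |>.hasDerivAt
  refine ⟨fun u => ∫ t in (-R)..u, θ t, ?_, ?_, hd⟩
  · rw [contDiff_infty_iff_deriv]
    refine ⟨fun x => (hd x).differentiableAt, ?_⟩
    rwa [funext fun x => (hd x).deriv]
  · refine HasCompactSupport.of_support_subset_isCompact (isCompact_Icc (a := -|R|) (b := |R|)) ?_
    intro x hx
    by_contra hxn
    refine hx ?_
    have hx' : |R| < |x| := by
      by_contra hcon
      exact hxn (abs_le.1 (not_lt.1 hcon))
    rcases le_or_gt 0 x with h | h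
    · rw [abs_of_nonneg h] at hx'
      have hRx := (le_abs_self R).trans_lt hx'
      have hRx' := (neg_le_abs R).trans_lt hx'
      beta_reduce
      rw [intervalIntegral.integral_of_le hRx'.le, ← h0]
      refine (integral_Icc_eq_integral_Ioc (f := θ)).symm.trans ?_
      refine setIntegral_eq_integral_of_forall_compl_eq_zero fun y hy => ?_
      by_cases hyR : R < |y|
      · exact hz y hyR
      · exact absurd ⟨(abs_le.1 (not_lt.1 hyR)).1, (abs_le.1 (not_lt.1 hyR)).2.trans hRx.le⟩ hy
    · rw [abs_of_neg h] at hx'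
      have h1 := (le_abs_self R).trans_lt hx'
      beta_reduce
      rw [intervalIntegral.integral_symm, intervalIntegral.integral_of_le (by linarith),
        integral_Ioc_eq_integral_Ioo, setIntegral_eq_zero_of_forall_eq_zero, neg_zero]
      intro y hy
      refine hz y ?_
      rcases le_or_gt 0 R with hR0 | hR0
      · rw [abs_of_neg (by linarith [hy.2])]
        linarith [hy.2]
      · exact hR0.trans_le (abs_nonneg _)

lemma exists_contDiff_hasCompactSupport_screened_lt {G h : ℝ → ℝ} (hG : ∀ x, HasDerivAt G (h x) x)
    (hh : ContDiff ℝ (⊤ : ℕ∞) h) (hL : eLpNorm h 2 volume < ∞) {ε : ℝ≥0∞} (hε : 0 < ε) :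
    ∃ φ : ℝ → ℝ, ContDiff ℝ (⊤ : ℕ∞) φ ∧ HasCompactSupport φ ∧
      eLpNorm (screenedQuotient fun x => G x - φ x) 2 volume ≤ 4 * ε := by
  obtain ⟨ψ, hψ, hψc, hψε⟩ := exists_contDiff_hasCompactSupport_eLpNorm_sub_lt hh hL hε
  obtain ⟨η, hη, hηc, hηm, hηε⟩ := exists_contDiff_integral_eq_eLpNorm_lt (∫ x, ψ x) hε
  obtain ⟨φ, hφ, hφc, hφd⟩ := exists_hasCompactSupport_primitive (hψ.sub hη) (hψc.sub hηc) (by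
    rw [integral_sub (hψ.continuous.integrable_of_hasCompactSupport hψc)
      (hη.continuous.integrable_of_hasCompactSupport hηc), hηm, sub_self])
  refine ⟨φ, hφ, hφc, ?_⟩
  have hhc := hh.continuous
  have hψ' := hψ.continuous
  have hη' := hη.continuous
  refine (eLpNorm_screenedQuotient_le (fun x => (hG x).sub (hφd x)) (by fun_prop)).trans ?_
  have e : (fun x => h x - (ψ x - η x)) = (fun x => h x - ψ x) + η := by
    ext x
    simp only [Pi.add_apply]
    ring
  calc 2 * eLpNorm (fun x => h x - (ψ x - η x)) 2 volume
      ≤ 2 * (ε + ε) := by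
        gcongr
        rw [e]
        exact (eLpNorm_add_le (hhc.sub hψ').aestronglyMeasurable hη'.aestronglyMeasurable
          one_le_two).trans (add_le_add hψε.le hηε.le)
    _ = 4 * ε := by ring

/-- density of `C_c^∞(ℝ)` in `Ḣ^{1/2}(ℝ)` for the screened seminorm:
for every locally integrable `f` with `|f|_{Ḣ^{1/2}(ℝ)} < ∞` and every `ε > 0`, there is
a smooth compactly supported `φ` with `|f − φ|_{Ḣ^{1/2}(ℝ)} ≤ ε`. -/
theorem statement15 (f : ℝ → ℝ) (hf : LocIntOn Set.univ f)
    (hfin : screenedSeminorm Set.univ 1 f < ⊤) (ε : ℝ) (hε : 0 < ε) :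
    ∃ φ : ℝ → ℝ, ContDiff ℝ (⊤ : ℕ∞) φ ∧ HasCompactSupport φ ∧
      screenedSeminorm Set.univ 1 (fun x => f x - φ x) ≤ ENNReal.ofReal ε := by
  have hloc : LocallyIntegrable f := by
    rw [locallyIntegrable_iff]
    exact fun k hk => hf k (subset_univ _) hk.measurableSet hk.isBounded
  have hfm : AEMeasurable f := hloc.aestronglyMeasurable.aemeasurable
  obtain ⟨f₁, hf₁, hff₁⟩ := hfm
  have hfm : AEMeasurable f := ⟨f₁, hf₁, hff₁⟩
  have hloc₁ : LocallyIntegrable f₁ := hloc.congr hff₁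
  have hK : MemLp (screenedQuotient f₁) 2 volume := by
    refine ⟨(measurable_screenedQuotient hf₁).aestronglyMeasurable, ?_⟩
    rwa [← eLpNorm_congr_ae (screenedQuotient_ae_eq hff₁), ← screenedSeminorm_eq_eLpNorm hfm]
  have hε' : 0 < ENNReal.ofReal (ε / 8) := ENNReal.ofReal_pos.2 (by linarith)
  obtain ⟨δ, hδ, hδε⟩ := exists_translation_lt hK hε'
  have hδ' : 0 < min δ 1 := lt_min hδ one_pos
  let b : ContDiffBump (0 : ℝ) :=
    ⟨min δ 1 / 4, min δ 1 / 2, by linarith, by linarith⟩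
  let r : ℝ → ℝ := b.normed volume
  have hr : ContDiff ℝ (⊤ : ℕ∞) r := b.contDiff_normed
  have hrc : HasCompactSupport r := b.hasCompactSupport_normed
  have hts : ∀ t ∈ tsupport r, |t| < min δ 1 := fun t ht => by
    rw [b.tsupport_normed_eq, mem_closedBall_zero_iff, Real.norm_eq_abs] at ht
    change |t| ≤ min δ 1 / 2 at ht
    linarith
  have hr' : ContDiff ℝ (⊤ : ℕ∞) (deriv r) := (contDiff_infty_iff_deriv.1 hr).2
  have hd := fun x => hrc.hasDerivAt_convolution_left (ContinuousLinearMap.lsmul ℝ ℝ)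
    (hr.of_le (by exact_mod_cast le_top)) hloc₁ x
  have hh := hrc.deriv.contDiff_convolution_left (ContinuousLinearMap.lsmul ℝ ℝ) hr' hloc₁
  have hr'0 : ∫ t, deriv r t = 0 :=
    integral_eq_zero_of_hasDerivAt_of_integrable
      (fun t => (contDiff_infty_iff_deriv.1 hr).1.differentiableAt.hasDerivAt)
      (hr'.continuous.integrable_of_hasCompactSupport hrc.deriv)
      (hr.continuous.integrable_of_hasCompactSupport hrc)
  have hL := eLpNorm_average_lt_top_of_integral_eq_zero hf₁ hloc₁ hr'.continuous hrc.deriv hr'0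
    (fun t ht => (hts t (support_deriv_subset ht)).trans_le (min_le_right _ _)) hK
  obtain ⟨φ, hφ, hφc, hφε⟩ := exists_contDiff_hasCompactSupport_screened_lt hd hh hL hε'
  have hmoll := eLpNorm_screenedQuotient_sub_average_le hf₁ hloc₁ hr.continuous hrc
    b.nonneg_normed b.integral_normed
    (fun t ht => (hts t (subset_tsupport _ ht)).trans_le (min_le_left _ _))
    (fun t ht => (hδε t ht).le)
  refine ⟨φ, hφ, hφc, ?_⟩
  change screenedSeminorm univ 1 (f - φ) ≤ _
  rw [screenedSeminorm_eq_eLpNorm (hfm.sub hφ.continuous.aemeasurable),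
    eLpNorm_congr_ae (screenedQuotient_ae_eq (hff₁.sub (EventuallyEq.refl _ φ)))]
  set g : ℝ → ℝ := fun x => ∫ t, r t * f₁ (x - t)
  have hgc : Continuous g := continuous_iff_continuousAt.2 fun x => (hd x).continuousAt
  have hsub : screenedQuotient (f₁ - φ) =
      screenedQuotient (fun x => f₁ x - g x) + screenedQuotient (fun x => g x - φ x) := by
    have e : (f₁ - φ) = fun x => f₁ x - φ x := rfl
    rw [e, screenedQuotient_sub, screenedQuotient_sub, screenedQuotient_sub, sub_add_sub_cancel]
  rw [hsub]
  calc _ ≤ _ := eLpNorm_add_le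
        (measurable_screenedQuotient (hf₁.sub hgc.measurable)).aestronglyMeasurable
        (measurable_screenedQuotient (hgc.sub hφ.continuous).measurable).aestronglyMeasurable
        one_le_two
    _ ≤ ENNReal.ofReal (ε / 8) + 4 * ENNReal.ofReal (ε / 8) := add_le_add hmoll hφε
    _ = ENNReal.ofReal (5 * (ε / 8)) := by
        rw [ENNReal.ofReal_mul (by norm_num)]
        norm_num
        ring
    _ ≤ ENNReal.ofReal ε := ENNReal.ofReal_le_ofReal (by linarith)
end

section
/- Let I ⊆ ℝ be a nonempty bounded open interval. For every f ∈ L¹(I) with |f|_{Ḣ^{1/2}(I)} < ∞ and every ε > 0, there exists an infinitely differentiable function φ : ℝ → ℝ with compact support contained in I such that |f − φ|_{Ḣ^{1/2}(I)} < ε and moreover | avg_I (f − φ) | < ε. -/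
open MeasureTheory Set Filter
open scoped ENNReal BigOperators

/-- The difference quotient of `f` as a function on the plane. -/
noncomputable def diffQuot (f : ℝ → ℝ) (p : ℝ × ℝ) : ℝ := (f p.2 - f p.1) / (p.2 - p.1)

/-- The pairs of points of `I` at distance less than one. -/
def screenedSquare (I : Set ℝ) : Set (ℝ × ℝ) :=
  {p | p.1 ∈ I ∧ p.2 ∈ I ∩ Ioo (p.1 - 1) (p.1 + 1)}

lemma measurableSet_screenedSquare {I : Set ℝ} (hI : MeasurableSet I) :
    MeasurableSet (screenedSquare I) := by
  have h1 : MeasurableSet {p : ℝ × ℝ | p.1 ∈ I} := measurable_fst hI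
  have h2 : MeasurableSet {p : ℝ × ℝ | p.2 ∈ I} := measurable_snd hI
  have h3 : MeasurableSet {p : ℝ × ℝ | p.1 - 1 < p.2} :=
    measurableSet_lt (by fun_prop) (by fun_prop)
  have h4 : MeasurableSet {p : ℝ × ℝ | p.2 < p.1 + 1} :=
    measurableSet_lt (by fun_prop) (by fun_prop)
  exact h1.inter (h2.inter (h3.inter h4))

lemma Measurable.diffQuot {f : ℝ → ℝ} (hf : Measurable f) : Measurable (diffQuot f) := by
  unfold _root_.diffQuot
  fun_prop

lemma diffQuot_sub (f g : ℝ → ℝ) : diffQuot (fun x => f x - g x) = diffQuot f - diffQuot g := by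
  ext p
  simp only [diffQuot, Pi.sub_apply]
  ring

lemma norm_diffQuot_le {f g : ℝ → ℝ} {p : ℝ × ℝ} (h : |f p.2 - f p.1| ≤ |g p.2 - g p.1|) :
    ‖diffQuot f p‖ ≤ ‖diffQuot g p‖ := by
  simp only [diffQuot, Real.norm_eq_abs, abs_div]
  gcongr

lemma screenedSeminorm_eq_eLpNorm_s16 {I : Set ℝ} (hI : MeasurableSet I) {f : ℝ → ℝ}
    (hf : Measurable f) :
    screenedSeminorm I 1 f = eLpNorm (diffQuot f) 2 (volume.restrict (screenedSquare I)) := by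
  have hm : Measurable fun p : ℝ × ℝ => ‖diffQuot f p‖ₑ ^ (2 : ℝ) :=
    (hf.diffQuot.enorm).pow_const _
  rw [eLpNorm_eq_lintegral_rpow_enorm_toReal (by norm_num) (by norm_num)]
  simp only [ENNReal.toReal_ofNat]
  rw [← lintegral_indicator (measurableSet_screenedSquare hI), Measure.volume_eq_prod,
    lintegral_prod _ (hm.indicator (measurableSet_screenedSquare hI)).aemeasurable,
    screenedSeminorm, ← lintegral_indicator hI]
  congr 1
  refine lintegral_congr fun x => ?_
  by_cases hx : x ∈ I
  · rw [indicator_of_mem hx, ← lintegral_indicator (hI.inter measurableSet_Ioo)]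
    refine lintegral_congr fun y => ?_
    by_cases hy : y ∈ I ∩ Ioo (x - 1) (x + 1)
    · rw [indicator_of_mem hy, indicator_of_mem (show (x, y) ∈ screenedSquare I from ⟨hx, hy⟩),
        ← ofReal_norm, ENNReal.ofReal_rpow_of_nonneg (norm_nonneg _) (by norm_num)]
      congr 1
      simp [diffQuot, div_pow]
    · rw [indicator_of_notMem hy, indicator_of_notMem fun h => hy h.2]
  · rw [indicator_of_notMem hx]
    simp [indicator, screenedSquare, hx]

lemma screenedSeminorm_congr_ae {I : Set ℝ} {f g : ℝ → ℝ} {r : ℝ}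
    (h : f =ᵐ[volume.restrict I] g) : screenedSeminorm I r f = screenedSeminorm I r g := by
  unfold screenedSeminorm
  congr 1
  refine lintegral_congr_ae ?_
  filter_upwards [h] with x hx
  refine lintegral_congr_ae ?_
  filter_upwards [ae_restrict_of_ae_restrict_of_subset inter_subset_left h] with y hy
  rw [hx, hy]

lemma tendsto_eLpNorm_two_of_dominated {α : Type*} [MeasurableSpace α] {μ : Measure α}
    {F : ℕ → α → ℝ} {G : α → ℝ} (hF : ∀ n, Measurable (F n)) (hG : MemLp G 2 μ)
    (hle : ∀ n a, ‖F n a‖ ≤ ‖G a‖) (hlim : ∀ᵐ a ∂μ, Tendsto (fun n => F n a) atTop (nhds 0)) :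
    Tendsto (fun n => eLpNorm (F n) 2 μ) atTop (nhds 0) := by
  simp only [eLpNorm_eq_lintegral_rpow_enorm_toReal (two_ne_zero) (ENNReal.ofNat_ne_top),
    ENNReal.toReal_ofNat]
  have key : Tendsto (fun n => ∫⁻ a, ‖F n a‖ₑ ^ (2 : ℝ) ∂μ) atTop (nhds (∫⁻ a, 0 ∂μ)) := by
    refine tendsto_lintegral_of_dominated_convergence (fun a => ‖G a‖ₑ ^ (2 : ℝ))
      (fun n => ((hF n).enorm).pow_const _) (fun n => ae_of_all _ fun a => ?_) ?_ ?_
    · have : ‖F n a‖ₑ ≤ ‖G a‖ₑ := enorm_le_iff_norm_le.2 (hle n a)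
      dsimp only
      gcongr
    · have := lintegral_rpow_enorm_lt_top_of_eLpNorm_lt_top two_ne_zero ENNReal.ofNat_ne_top hG.2
      simpa using this.ne
    · filter_upwards [hlim] with a ha
      have := (ENNReal.continuous_rpow_const (y := (2 : ℝ))).tendsto 0 |>.comp
        (by simpa using ha.enorm : Tendsto (fun n => ‖F n a‖ₑ) atTop (nhds 0))
      simpa [Function.comp_def] using this
  have := (ENNReal.continuous_rpow_const (y := (1 / 2 : ℝ))).tendsto 0 |>.comp
    (by simpa using key : Tendsto (fun n => ∫⁻ a, ‖F n a‖ₑ ^ (2 : ℝ) ∂μ) atTop (nhds 0))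
  simpa [Function.comp_def] using this

lemma exists_bounded_approx {I : Set ℝ} {f : ℝ → ℝ} (hf : Measurable f)
    (hsupp : Function.support f ⊆ I) (hint : Integrable f)
    (hE : MemLp (diffQuot f) 2 (volume.restrict (screenedSquare I))) {ε : ℝ} (hε : 0 < ε) :
    ∃ g : ℝ → ℝ, Measurable g ∧ Function.support g ⊆ I ∧ Integrable g ∧
      MemLp (diffQuot g) 2 (volume.restrict (screenedSquare I)) ∧ (∃ M, ∀ x, |g x| ≤ M) ∧
      eLpNorm (diffQuot fun x => f x - g x) 2 (volume.restrict (screenedSquare I))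
        < ENNReal.ofReal ε ∧ |∫ x, (f x - g x)| < ε := by
  set g : ℕ → ℝ → ℝ := fun n x => max (min (f x) n) (-n) with hg
  have hgm : ∀ n, Measurable (g n) := fun n => by fun_prop
  have hlim : ∀ x, Tendsto (fun n => f x - g n x) atTop (nhds 0) := fun x => by
    refine tendsto_const_nhds.congr' ?_
    filter_upwards [eventually_ge_atTop ⌈|f x|⌉₊] with n hn
    have h1 : |f x| ≤ n := Nat.ceil_le.1 hn
    simp only [hg]
    rw [min_eq_left (le_of_abs_le h1), max_eq_left (neg_le_of_abs_le h1), sub_self]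
  have hgle : ∀ n x, |g n x| ≤ |f x| := fun n x => by
    have h0 : (0 : ℝ) ≤ n := n.cast_nonneg
    simp only [hg]
    rcases max_cases (min (f x) (n : ℝ)) (-n) with h | h <;>
      rcases min_cases (f x) (n : ℝ) with h' | h' <;>
      rcases abs_cases (max (min (f x) (n : ℝ)) (-n)) with h'' | h'' <;>
      rcases abs_cases (f x) with h3 | h3 <;> linarith
  have hsub : ∀ n x y, |(f y - g n y) - (f x - g n x)| ≤ |f y - f x| := fun n x y => by
    have h0 : (0 : ℝ) ≤ n := n.cast_nonneg
    simp only [hg]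
    rcases max_cases (min (f x) (n : ℝ)) (-n) with h | h <;>
      rcases min_cases (f x) (n : ℝ) with h' | h' <;>
      rcases max_cases (min (f y) (n : ℝ)) (-n) with k | k <;>
      rcases min_cases (f y) (n : ℝ) with k' | k' <;>
      rw [abs_le] <;>
      rcases abs_cases (f y - f x) with h3 | h3 <;> constructor <;> linarith
  have hsub' : ∀ n x y, |g n y - g n x| ≤ |f y - f x| := fun n x y =>
    (abs_max_sub_max_le_abs _ _ _).trans (abs_inf_sub_inf_le_abs (f y) (f x) (n : ℝ))
  have hgint : ∀ n, Integrable (g n) := fun n =>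
    hint.mono (hgm n).aestronglyMeasurable (ae_of_all _ (hgle n))
  have hA := tendsto_eLpNorm_two_of_dominated (F := fun n => diffQuot fun x => f x - g n x)
    (fun n => (hf.sub (hgm n)).diffQuot) hE (fun n p => norm_diffQuot_le (hsub n p.1 p.2))
    (ae_of_all _ fun p => by
      simpa [diffQuot] using ((hlim p.2).sub (hlim p.1)).div_const (p.2 - p.1))
  have hB : Tendsto (fun n => ∫ x, (f x - g n x)) atTop (nhds (∫ x : ℝ, (0 : ℝ))) :=
    tendsto_integral_of_dominated_convergence (fun x => 2 * |f x|)
      (fun n => (hf.sub (hgm n)).aestronglyMeasurable) (hint.abs.const_mul 2)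
      (fun n => ae_of_all _ fun x => by
        have := (abs_sub (f x) (g n x)).trans (add_le_add_right (hgle n x) _)
        rw [Real.norm_eq_abs]; linarith) (ae_of_all _ hlim)
  rw [integral_zero] at hB
  obtain ⟨n, hn1, hn2⟩ := ((hA.eventually_lt_const (ENNReal.ofReal_pos.2 hε)).and
    (hB.abs.eventually_lt_const (by simpa using hε))).exists
  refine ⟨g n, hgm n, fun x hx => hsupp ?_, hgint n, ?_, ⟨n, fun x => ?_⟩, hn1, hn2⟩
  · intro h0
    refine hx ?_
    have := hgle n x
    rw [h0, abs_zero] at this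
    exact abs_eq_zero.1 (le_antisymm this (abs_nonneg _))
  · exact hE.mono (hgm n).diffQuot.aestronglyMeasurable
      (ae_of_all _ fun p => norm_diffQuot_le (hsub' n p.1 p.2))
  · exact abs_le.2 ⟨le_max_right _ _, max_le (min_le_right _ _) (by simp)⟩

lemma log_div_sq_le {x y : ℝ} (hx : 0 < x) (hxy : x < y) :
    Real.log (y / x) ^ 2 ≤ 16 * ((y - x) ^ 2 / y ^ 2) * (√y / √x) := by
  have hy : 0 < y := hx.trans hxy
  set w : ℝ := √(√(x / y)) with hw
  have hw0 : 0 < w := by positivity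
  have hw2 : w ^ 2 = √(x / y) := Real.sq_sqrt (by positivity)
  have hw4 : w ^ 4 = x / y := by
    rw [show w ^ 4 = (w ^ 2) ^ 2 by ring, hw2, Real.sq_sqrt (by positivity)]
  have hw1 : w < 1 := by
    by_contra! h
    have := one_le_pow₀ (n := 4) h
    rw [hw4, one_le_div hy] at this
    linarith
  have hlog : Real.log (y / x) = 4 * Real.log w⁻¹ := by
    rw [← Nat.cast_ofNat (n := 4), ← Real.log_pow, inv_pow, hw4, inv_div]
  have h1 : Real.log w⁻¹ ≤ (1 - w) / w := by
    refine (Real.log_le_sub_one_of_pos (by positivity)).trans_eq ?_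
    field_simp
  have h0 : 0 ≤ Real.log w⁻¹ := Real.log_nonneg (one_le_inv₀ hw0 |>.2 hw1.le)
  have h2 : (y - x) / y = 1 - w ^ 4 := by rw [hw4]; field_simp
  have h3 : √y / √x = (w ^ 2)⁻¹ := by
    rw [hw2, Real.sqrt_div hx.le, inv_div]
  have h4 : w ^ 4 ≤ w := pow_le_of_le_one hw0.le hw1.le (by norm_num)
  rw [hlog, ← div_pow, h2, h3]
  calc (4 * Real.log w⁻¹) ^ 2 ≤ (4 * ((1 - w ^ 4) / w)) ^ 2 := by
        have : (1 - w) / w ≤ (1 - w ^ 4) / w := by gcongr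
        gcongr
        exact h1.trans this
    _ = _ := by field_simp; ring

/-- The iterated logarithm, an unbounded function of finite energy near `0`. -/
noncomputable def logLog (L t : ℝ) : ℝ := Real.log (-Real.log (t / (Real.exp 1 * L)))

lemma measurable_logLog (L : ℝ) : Measurable (logLog L) := by
  unfold logLog
  fun_prop

lemma one_le_neg_log {L t : ℝ} (ht : t ∈ Ioo 0 L) : 1 ≤ -Real.log (t / (Real.exp 1 * L)) := by
  have hL : 0 < L := ht.1.trans ht.2
  rw [← Real.log_inv, Real.le_log_iff_exp_le (by have := ht.1; positivity), inv_div,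
    le_div_iff₀ ht.1]
  have := ht.2.le
  gcongr

lemma sq_diffQuot_logLog_le {L x y : ℝ} (hx : x ∈ Ioo 0 L) (hy : y ∈ Ioo 0 L) (hxy : x < y) :
    diffQuot (logLog L) (x, y) ^ 2 ≤
      (√x)⁻¹ * (16 * (√y)⁻¹ * (y⁻¹ / Real.log (y / (Real.exp 1 * L)) ^ 2)) := by
  have hL : 0 < L := hx.1.trans hx.2
  have hx1 := one_le_neg_log hx
  have hy1 := one_le_neg_log hy
  have hx0 := hx.1
  have hy0 := hy.1
  set c := Real.exp 1 * L with hc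
  have hc0 : 0 < c := by positivity
  set l := -Real.log (x / c) with hl
  set m := -Real.log (y / c) with hm
  have hlm : l - m = Real.log (y / x) := by
    rw [hl, hm, Real.log_div hx0.ne' hc0.ne', Real.log_div hy0.ne' hc0.ne',
      Real.log_div hy0.ne' hx0.ne']
    ring
  have hpos : 0 ≤ Real.log (y / x) := Real.log_nonneg (by rw [one_le_div hx0]; exact hxy.le)
  have hv : logLog L x - logLog L y = Real.log (l / m) := by
    rw [Real.log_div (by linarith) (by linarith)]; rfl
  have h0 : 0 ≤ Real.log (l / m) := Real.log_nonneg (by rw [one_le_div (by linarith)]; linarith)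
  have h1 : Real.log (l / m) ≤ Real.log (y / x) / m := by
    refine (Real.log_le_sub_one_of_pos (by apply div_pos <;> linarith)).trans_eq ?_
    rw [← hlm, sub_div, div_self (by linarith)]
  have h2 : (Real.log (l / m)) ^ 2 ≤ 16 * ((y - x) ^ 2 / y ^ 2) * (√y / √x) / m ^ 2 := by
    calc _ ≤ (Real.log (y / x) / m) ^ 2 := by gcongr
      _ = Real.log (y / x) ^ 2 / m ^ 2 := div_pow _ _ _
      _ ≤ _ := by gcongr; exact log_div_sq_le hx0 hxy
  have h3 : Real.log (y / c) ^ 2 = m ^ 2 := by rw [hm, neg_sq]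
  have hyx : 0 < y - x := sub_pos.2 hxy
  have hm0 : 0 < m := by linarith
  rw [h3, diffQuot, div_pow, ← neg_sub, neg_sq, hv, div_le_iff₀ (by positivity)]
  refine h2.trans_eq ?_
  have hs : √y * √y = y := Real.mul_self_sqrt hy0.le
  field_simp
  rw [Real.sq_sqrt hy0.le]

lemma lintegral_inv_sqrt_le {y : ℝ} (hy : 0 < y) :
    ∫⁻ x in Ioo 0 y, ENNReal.ofReal (√x)⁻¹ ≤ ENNReal.ofReal (2 * √y) := by
  have hcongr : ∀ x : ℝ, x ∈ Ioo 0 y → (√x)⁻¹ = x ^ (-(1 / 2) : ℝ) := fun x hx => by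
    rw [Real.rpow_neg hx.1.le, Real.sqrt_eq_rpow]
  have hi : IntervalIntegrable (fun x : ℝ => x ^ (-(1 / 2) : ℝ)) volume 0 y :=
    intervalIntegral.intervalIntegrable_rpow' (by norm_num)
  have hi' : IntegrableOn (fun x : ℝ => x ^ (-(1 / 2) : ℝ)) (Ioo 0 y) :=
    ((intervalIntegrable_iff_integrableOn_Ioc_of_le hy.le).1 hi).mono_set Ioo_subset_Ioc_self
  rw [setLIntegral_congr_fun measurableSet_Ioo fun x hx => by rw [hcongr x hx],
    ← ofReal_integral_eq_lintegral_ofReal hi'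
      ((ae_restrict_mem measurableSet_Ioo).mono fun x hx => Real.rpow_nonneg hx.1.le _),
    ← integral_Ioc_eq_integral_Ioo, ← intervalIntegral.integral_of_le hy.le,
    integral_rpow (Or.inl (by norm_num))]
  refine ENNReal.ofReal_le_ofReal (le_of_eq ?_)
  rw [Real.sqrt_eq_rpow, Real.zero_rpow (by norm_num)]
  norm_num
  ring

lemma integrableOn_inv_div_log_sq {L : ℝ} (hL : 0 < L) :
    IntegrableOn (fun y : ℝ => y⁻¹ / Real.log (y / (Real.exp 1 * L)) ^ 2) (Ioo 0 L) := by
  set c := Real.exp 1 * L with hc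
  have hc0 : 0 < c := by positivity
  have hneg : ∀ y ∈ Ioc 0 L, Real.log (y / c) < 0 := fun y hy => by
    refine Real.log_neg (div_pos hy.1 hc0) ((div_lt_one hc0).2 (hy.2.trans_lt ?_))
    have := Real.one_lt_exp_iff.2 one_pos
    nlinarith
  have hderiv : ∀ y ∈ Ioc 0 L, HasDerivAt (fun y => -(Real.log (y / c))⁻¹)
      (y⁻¹ / Real.log (y / c) ^ 2) y := fun y hy => by
    have h1 : HasDerivAt (fun y => Real.log (y / c)) (y⁻¹) y := by
      have := ((hasDerivAt_id y).div_const c).log (div_pos hy.1 hc0).ne'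
      refine this.congr_deriv ?_
      have := hy.1
      simp only [id]
      field_simp
    refine (h1.inv (hneg y hy).ne).neg.congr_deriv ?_
    ring
  refine (intervalIntegral.integrableOn_deriv_of_nonneg (g := fun y => -(Real.log (y / c))⁻¹) ?_
    (fun y hy => hderiv y ⟨hy.1, hy.2.le⟩) fun y hy => ?_).mono_set Ioo_subset_Ioc_self
  · intro y hy
    rcases hy.1.eq_or_lt with rfl | h0
    · refine ContinuousAt.continuousWithinAt ?_
      rw [← continuousWithinAt_compl_self, ContinuousWithinAt]
      have h1 : Tendsto (fun y : ℝ => y / c) (nhdsWithin 0 {0}ᶜ) (nhdsWithin 0 {0}ᶜ) := by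
        refine tendsto_nhdsWithin_iff.2 ⟨?_, ?_⟩
        · have : Continuous fun y : ℝ => y / c := by fun_prop
          simpa using (this.tendsto 0).mono_left nhdsWithin_le_nhds
        · filter_upwards [self_mem_nhdsWithin] with y hy
          exact div_ne_zero hy hc0.ne'
      have := (tendsto_inv_atBot_zero.comp (Real.tendsto_log_nhdsNE_zero.comp h1)).neg
      simpa [Function.comp_def] using this
    · exact (hderiv y ⟨h0, hy.2⟩).continuousAt.continuousWithinAt
  · have := hy.1
    positivity

lemma memLp_diffQuot_logLog {L : ℝ} (hL : 0 < L) :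
    MemLp (diffQuot (logLog L)) 2 (volume.restrict (Ioo 0 L ×ˢ Ioo 0 L)) := by
  refine ⟨(measurable_logLog L).diffQuot.aestronglyMeasurable, ?_⟩
  rw [eLpNorm_lt_top_iff_lintegral_rpow_enorm_lt_top two_ne_zero ENNReal.ofNat_ne_top]
  set q : ℝ → ℝ := fun y => 16 * (√y)⁻¹ * (y⁻¹ / Real.log (y / (Real.exp 1 * L)) ^ 2) with hq
  set k : ℝ → ℝ → ℝ≥0∞ := fun x y => (Iio y).indicator (fun x => ENNReal.ofReal (√x)⁻¹) x *
    ENNReal.ofReal (q y) with hk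
  have hkm : Measurable fun p : ℝ × ℝ => k p.1 p.2 := by
    refine Measurable.mul ?_ (by fun_prop)
    have : Measurable ({p : ℝ × ℝ | p.1 < p.2}.indicator fun p => ENNReal.ofReal (√p.1)⁻¹) :=
      Measurable.indicator (by fun_prop) (measurableSet_lt measurable_fst measurable_snd)
    exact this
  have hkm' : Measurable fun p : ℝ × ℝ => k p.2 p.1 := hkm.comp measurable_swap
  have hle : ∀ x ∈ Ioo 0 L, ∀ y ∈ Ioo 0 L, x < y →
      ENNReal.ofReal (diffQuot (logLog L) (x, y) ^ 2) ≤ k x y := fun x hx y hy hxy => by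
    simp only [hk]
    rw [indicator_of_mem (show x ∈ Iio y from hxy), ← ENNReal.ofReal_mul (by positivity)]
    exact ENNReal.ofReal_le_ofReal (sq_diffQuot_logLog_le hx hy hxy)
  have hkfin : ∫⁻ y in Ioo 0 L, ∫⁻ x in Ioo 0 L, k x y < ∞ := by
    refine lt_of_le_of_lt (setLIntegral_mono' (g := fun y => ENNReal.ofReal
      (32 * (y⁻¹ / Real.log (y / (Real.exp 1 * L)) ^ 2))) measurableSet_Ioo fun y hy => ?_)
      ((integrableOn_inv_div_log_sq hL).const_mul 32).lintegral_lt_top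
    simp only [hk]
    rw [lintegral_mul_const _ (Measurable.indicator (by fun_prop) measurableSet_Iio),
      setLIntegral_indicator measurableSet_Iio,
      show Iio y ∩ Ioo 0 L = Ioo 0 y by ext x; simp; grind]
    grw [lintegral_inv_sqrt_le hy.1]
    rw [← ENNReal.ofReal_mul (by positivity)]
    refine ENNReal.ofReal_le_ofReal (le_of_eq ?_)
    have : √y ≠ 0 := (Real.sqrt_pos.2 hy.1).ne'
    simp only [hq]
    field_simp
    norm_num
  calc _ ≤ ∫⁻ p in Ioo 0 L ×ˢ Ioo 0 L, (k p.1 p.2 + k p.2 p.1) := by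
        refine setLIntegral_mono' (measurableSet_Ioo.prod measurableSet_Ioo) fun p hp => ?_
        rw [← ofReal_norm, ENNReal.ofReal_rpow_of_nonneg (norm_nonneg _) (by norm_num)]
        simp only [ENNReal.toReal_ofNat, Real.rpow_ofNat, Real.norm_eq_abs, sq_abs]
        rcases lt_trichotomy p.1 p.2 with h | h | h
        · exact (hle _ hp.1 _ hp.2 h).trans le_self_add
        · simp [diffQuot, h]
        · refine le_trans ?_ ((hle _ hp.2 _ hp.1 h).trans le_add_self)
          refine ENNReal.ofReal_le_ofReal (le_of_eq ?_)
          rw [diffQuot, diffQuot, ← neg_sub, ← neg_sub p.1, neg_div_neg_eq]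
    _ < ∞ := by
        rw [lintegral_add_left hkm, Measure.volume_eq_prod, ← Measure.prod_restrict,
          lintegral_prod_symm _ hkm.aemeasurable, lintegral_prod _ hkm'.aemeasurable]
        exact ENNReal.add_lt_top.2 ⟨hkfin, hkfin⟩

lemma MeasureTheory.MemLp.diffQuot_comp {f g : ℝ → ℝ} {s t : Set ℝ}
    (hf : MemLp (diffQuot f) 2 (volume.restrict (s ×ˢ s))) (hfm : Measurable f)
    (hs : MeasurableSet s) (hg : MeasurePreserving g) (hgt : t = g ⁻¹' s)
    (hdist : ∀ x y, |g y - g x| = |y - x|) :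
    MemLp (diffQuot (f ∘ g)) 2 (volume.restrict (t ×ˢ t)) := by
  have hG : MeasurePreserving (Prod.map g g) (volume : Measure (ℝ × ℝ)) volume := hg.prod hg
  have := hf.comp_measurePreserving (hG.restrict_preimage (hs.prod hs))
  rw [hgt]
  refine (memLp_congr_norm this.1 (hfm.comp hg.measurable).diffQuot.aestronglyMeasurable
    (ae_of_all _ fun p => ?_)).1 this
  simp [diffQuot, hdist]

lemma exists_barrier {a b : ℝ} (hab : a < b) :
    ∃ u : ℝ → ℝ, Measurable u ∧ (∀ x, 0 ≤ u x) ∧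
      MemLp (diffQuot u) 2 (volume.restrict (screenedSquare (Ioo a b))) ∧
      ∀ N : ℝ, ∃ α β, a < α ∧ β < b ∧ ∀ x ∈ Ioo a b, u x < N → x ∈ Icc α β := by
  have hL : 0 < b - a := sub_pos.2 hab
  set L := b - a with hLdef
  set c := Real.exp 1 * L with hc
  have hc0 : 0 < c := by positivity
  have hvm := measurable_logLog L
  have hsub : screenedSquare (Ioo a b) ⊆ Ioo a b ×ˢ Ioo a b := fun p hp => ⟨hp.1, hp.2.1⟩
  have habs : ∀ g : ℝ → ℝ, MeasurePreserving g → Ioo a b = g ⁻¹' Ioo 0 L →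
      (∀ x y, |g y - g x| = |y - x|) →
      MemLp (diffQuot fun x => |logLog L (g x)|) 2
        (volume.restrict (screenedSquare (Ioo a b))) := fun g hg h1 h2 => by
    refine MemLp.mono (((memLp_diffQuot_logLog hL).diffQuot_comp hvm measurableSet_Ioo hg h1
      h2).mono_measure (Measure.restrict_mono_set _ hsub))
      (hvm.comp hg.measurable).abs.diffQuot.aestronglyMeasurable (ae_of_all _ fun p => ?_)
    exact norm_diffQuot_le (abs_abs_sub_abs_le_abs_sub _ _)
  have hl := habs (fun x => x - a) (measurePreserving_sub_right volume a)
    (by ext x; simp only [mem_Ioo, mem_preimage]; grind) (fun x y => by ring_nf)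
  have hr := habs (fun x => b - x) (Measure.measurePreserving_sub_left volume b)
    (by ext x; simp only [mem_Ioo, mem_preimage]; grind)
    (fun x y => by rw [abs_sub_comm y x]; ring_nf)
  have hlarge : ∀ N t : ℝ, t ∈ Ioo 0 L → |logLog L t| < N → c * Real.exp (-Real.exp N) ≤ t := by
    intro N t ht hN
    have h1 := one_le_neg_log ht
    have h2 : -Real.log (t / c) < Real.exp N :=
      (Real.log_lt_iff_lt_exp (by linarith)).1 ((le_abs_self _).trans_lt hN)
    have h3 : Real.exp (-Real.exp N) < t / c :=
      (Real.lt_log_iff_exp_lt (div_pos ht.1 hc0)).1 (by linarith)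
    rw [lt_div_iff₀ hc0] at h3
    linarith
  refine ⟨fun x => |logLog L (x - a)| + |logLog L (b - x)|, ?_, fun x => by positivity, ?_,
    fun N => ⟨a + c * Real.exp (-Real.exp N), b - c * Real.exp (-Real.exp N), ?_, ?_, ?_⟩⟩
  · exact (hvm.comp (measurable_id.sub_const a)).abs.add
      (hvm.comp (measurable_id.const_sub b)).abs
  · refine (hl.add hr).congr_norm ?_ (ae_of_all _ fun p => ?_)
    · exact ((hvm.comp (measurable_id.sub_const a)).abs.add
        (hvm.comp (measurable_id.const_sub b)).abs).diffQuot.aestronglyMeasurable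
    · congr 1
      simp only [diffQuot, Pi.add_apply]
      ring
  · have : 0 < c * Real.exp (-Real.exp N) := by positivity
    linarith
  · have : 0 < c * Real.exp (-Real.exp N) := by positivity
    linarith
  · intro x hx hN
    have h1 := hlarge N (x - a) ⟨by linarith [hx.1], by linarith [hx.2]⟩
      (by linarith [abs_nonneg (logLog L (b - x))])
    have h2 := hlarge N (b - x) ⟨by linarith [hx.2], by linarith [hx.1]⟩
      (by linarith [abs_nonneg (logLog L (x - a))])
    exact ⟨by linarith, by linarith⟩

lemma exists_compactSupport_approx {a b : ℝ} (hab : a < b) {f : ℝ → ℝ} (hf : Measurable f)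
    (hsupp : Function.support f ⊆ Ioo a b) (hint : Integrable f)
    (hE : MemLp (diffQuot f) 2 (volume.restrict (screenedSquare (Ioo a b))))
    {M : ℝ} (hM : ∀ x, |f x| ≤ M) {ε : ℝ} (hε : 0 < ε) :
    ∃ g : ℝ → ℝ, Measurable g ∧ (∃ α β, a < α ∧ β < b ∧ Function.support g ⊆ Icc α β) ∧
      Integrable g ∧ MemLp (diffQuot g) 2 (volume.restrict (screenedSquare (Ioo a b))) ∧
      (∀ x, |g x| ≤ M) ∧
      eLpNorm (diffQuot fun x => f x - g x) 2 (volume.restrict (screenedSquare (Ioo a b)))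
        < ENNReal.ofReal ε ∧ |∫ x, (f x - g x)| < ε := by
  obtain ⟨u, hum, hu0, huE, hu⟩ := exists_barrier hab
  set μ := volume.restrict (screenedSquare (Ioo a b))
  have hM0 : 0 ≤ M := (abs_nonneg _).trans (hM 0)
  set m : ℕ → ℝ → ℝ := fun n x => min (u x / (n + 1)) 1 with hm
  have hmm : ∀ n, Measurable (m n) := fun n => by fun_prop
  have hm0 : ∀ n x, 0 ≤ m n x := fun n x => le_min (div_nonneg (hu0 x) (by positivity)) zero_le_one
  have hm1 : ∀ n x, m n x ≤ 1 := fun n x => min_le_right _ _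
  have hmu : ∀ n x y, |m n y - m n x| ≤ |u y - u x| / (n + 1) := fun n x y => by
    refine (abs_inf_sub_inf_le_abs _ _ _).trans_eq ?_
    rw [← sub_div, abs_div, abs_of_pos (by positivity : (0 : ℝ) < n + 1)]
  have hdiv : ∀ t : ℝ, Tendsto (fun n : ℕ => t / ((n : ℝ) + 1)) atTop (nhds 0) := fun t => by
    simpa [div_eq_mul_inv] using tendsto_one_div_add_atTop_nhds_zero_nat.const_mul t
  have hmlim : ∀ x, Tendsto (fun n => m n x) atTop (nhds 0) := fun x =>
    squeeze_zero (fun n => hm0 n x) (fun n => min_le_left _ _) (hdiv (u x))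
  have hfm : ∀ n x, |f x * m n x| ≤ |f x| := fun n x => by
    rw [abs_mul, abs_of_nonneg (hm0 n x)]
    exact mul_le_of_le_one_right (abs_nonneg _) (hm1 n x)
  have hg : ∀ n x, |f x * (1 - m n x)| ≤ |f x| := fun n x => by
    rw [abs_mul, abs_of_nonneg (sub_nonneg.2 (hm1 n x))]
    exact mul_le_of_le_one_right (abs_nonneg _) (by linarith [hm0 n x])
  set A : ℕ → ℝ × ℝ → ℝ := fun n p => m n p.1 * diffQuot f p with hA
  set B : ℕ → ℝ × ℝ → ℝ := fun n p => f p.2 * diffQuot (m n) p with hB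
  have hAm : ∀ n, Measurable (A n) := fun n => ((hmm n).comp measurable_fst).mul hf.diffQuot
  have hBm : ∀ n, Measurable (B n) := fun n => (hf.comp measurable_snd).mul (hmm n).diffQuot
  have hAB : ∀ n, diffQuot (fun x => f x * m n x) = A n + B n := fun n => by
    ext p
    simp only [diffQuot, hA, hB, Pi.add_apply]
    ring
  have hAle : ∀ n p, ‖A n p‖ ≤ ‖diffQuot f p‖ := fun n p => by
    simp only [hA, norm_mul, Real.norm_of_nonneg (hm0 n p.1)]
    exact mul_le_of_le_one_left (norm_nonneg _) (hm1 n p.1)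
  have hBle' : ∀ n p, ‖B n p‖ ≤ ‖M * diffQuot u p‖ / (n + 1) := fun n p => by
    simp only [hB, diffQuot, norm_mul, norm_div, Real.norm_eq_abs, abs_of_nonneg hM0]
    calc _ ≤ M * (|u p.2 - u p.1| / (n + 1) / |p.2 - p.1|) := by
          gcongr
          exacts [hM _, hmu n _ _]
      _ = _ := by ring
  have hBle : ∀ n p, ‖B n p‖ ≤ ‖M * diffQuot u p‖ := fun n p =>
    (hBle' n p).trans (div_le_self (norm_nonneg _) (by simp))
  have huM : MemLp (fun p => M * diffQuot u p) 2 μ := huE.const_mul M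
  have hAlim := tendsto_eLpNorm_two_of_dominated hAm hE hAle
    (ae_of_all _ fun p => by simpa [hA] using (hmlim p.1).mul_const (diffQuot f p))
  have hBlim := tendsto_eLpNorm_two_of_dominated hBm huM hBle
    (ae_of_all _ fun p => squeeze_zero_norm (fun n => hBle' n p) (hdiv _))
  have hlim : Tendsto (fun n => eLpNorm (diffQuot fun x => f x * m n x) 2 μ) atTop (nhds 0) := by
    refine tendsto_of_tendsto_of_tendsto_of_le_of_le tendsto_const_nhds
      (by simpa using hAlim.add hBlim) (fun n => zero_le) fun n => ?_
    simp only [hAB]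
    exact eLpNorm_add_le (hAm n).aestronglyMeasurable (hBm n).aestronglyMeasurable (by norm_num)
  have hIlim : Tendsto (fun n => ∫ x, f x * m n x) atTop (nhds (∫ x : ℝ, (0 : ℝ))) :=
    tendsto_integral_of_dominated_convergence (fun x => |f x|)
      (fun n => (hf.mul (hmm n)).aestronglyMeasurable) hint.abs
      (fun n => ae_of_all _ fun x => hfm n x)
      (ae_of_all _ fun x => by simpa using (hmlim x).const_mul (f x))
  rw [integral_zero] at hIlim
  obtain ⟨n, hn1, hn2⟩ := ((hlim.eventually_lt_const (ENNReal.ofReal_pos.2 hε)).and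
    (hIlim.abs.eventually_lt_const (by simpa using hε))).exists
  have hsub : (fun x => f x - f x * (1 - m n x)) = fun x => f x * m n x := by ext x; ring
  have hgm : Measurable fun x => f x * (1 - m n x) := hf.mul ((hmm n).const_sub 1)
  refine ⟨fun x => f x * (1 - m n x), hgm, ?_, ?_, ?_, fun x => (hg n x).trans (hM x), ?_, ?_⟩
  · obtain ⟨α, β, hα, hβ, h⟩ := hu (n + 1)
    refine ⟨α, β, hα, hβ, fun x hx => h x (hsupp (left_ne_zero_of_mul hx)) ?_⟩
    by_contra! h'
    refine right_ne_zero_of_mul hx ?_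
    simp only [hm]
    rw [min_eq_right ((one_le_div (by positivity)).2 h'), sub_self]
  · exact hint.mono hgm.aestronglyMeasurable (ae_of_all _ (hg n))
  · have h1 := hE.sub ((hE.mono (hAm n).aestronglyMeasurable (ae_of_all _ (hAle n))).add
      (huM.mono (hBm n).aestronglyMeasurable (ae_of_all _ (hBle n))))
    rw [← hAB, ← diffQuot_sub] at h1
    convert h1 using 3
    ring
  · rwa [hsub]
  · rwa [hsub]

/-- The difference quotient of `f` over all pairs of reals at distance less than one. -/
noncomputable def stripQuot (f : ℝ → ℝ) : ℝ × ℝ → ℝ :=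
  (screenedSquare univ).indicator (diffQuot f)

lemma Measurable.stripQuot {f : ℝ → ℝ} (hf : Measurable f) : Measurable (stripQuot f) :=
  hf.diffQuot.indicator (measurableSet_screenedSquare MeasurableSet.univ)

lemma memLp_stripQuot {a b α β M : ℝ} {g : ℝ → ℝ} (hg : Measurable g) (ha : a < α) (hb : β < b)
    (hsupp : Function.support g ⊆ Icc α β) (hM : ∀ x, |g x| ≤ M)
    (hE : MemLp (diffQuot g) 2 (volume.restrict (screenedSquare (Ioo a b)))) :
    MemLp (stripQuot g) 2 volume := by
  have hS : MeasurableSet (screenedSquare (Ioo a b)) :=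
    measurableSet_screenedSquare measurableSet_Ioo
  have hM0 : 0 ≤ M := (abs_nonneg _).trans (hM 0)
  set δ := min (α - a) (b - β) with hδ
  have hδ0 : 0 < δ := lt_min (by linarith) (by linarith)
  set B : Set (ℝ × ℝ) := Icc (a - 1) (b + 1) ×ˢ Icc (a - 1) (b + 1) with hB
  have hBm : MeasurableSet B := measurableSet_Icc.prod measurableSet_Icc
  have hBfin : volume B ≠ ∞ := (isCompact_Icc.prod isCompact_Icc).measure_ne_top
  have h1 : MemLp ((screenedSquare (Ioo a b)).indicator (fun p => |diffQuot g p|)) 2 volume :=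
    (memLp_indicator_iff_restrict hS).2 hE.abs
  have h2 : MemLp (B.indicator fun _ => 2 * M / δ) 2 volume :=
    memLp_indicator_const 2 hBm _ (Or.inr hBfin)
  refine (h1.add h2).mono hg.stripQuot.aestronglyMeasurable (ae_of_all _ fun p => ?_)
  have h2p : 0 ≤ B.indicator (fun _ => 2 * M / δ) p :=
    indicator_nonneg (fun _ _ => by positivity) p
  have h1p : 0 ≤ (screenedSquare (Ioo a b)).indicator (fun p => |diffQuot g p|) p :=
    indicator_nonneg (fun _ _ => abs_nonneg _) p
  rw [Real.norm_eq_abs, Real.norm_eq_abs, Pi.add_apply, abs_of_nonneg (add_nonneg h1p h2p)]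
  by_cases hp : p ∈ screenedSquare (Ioo a b)
  · have hp' : p ∈ screenedSquare univ := ⟨mem_univ _, mem_univ _, hp.2.2⟩
    rw [indicator_of_mem hp, stripQuot, indicator_of_mem hp']
    linarith
  rw [indicator_of_notMem hp, zero_add]
  by_cases hp' : p ∈ screenedSquare univ
  swap
  · rwa [stripQuot, indicator_of_notMem hp', abs_zero]
  rw [stripQuot, indicator_of_mem hp']
  have hfar : ∀ x y : ℝ, x ∈ Icc α β → y ∉ Ioo a b → δ ≤ |y - x| := fun x y hx hy => by
    have e1 : δ ≤ α - a := min_le_left _ _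
    have e2 : δ ≤ b - β := min_le_right _ _
    rw [le_abs]
    by_cases h : a < y
    · have : b ≤ y := by by_contra! h'; exact hy ⟨h, h'⟩
      left; linarith [hx.2]
    · right; linarith [hx.1]
  obtain ⟨-, -, hp1, hp2⟩ := hp'
  have hle : ∀ {d : ℝ}, δ ≤ |d| → |(g p.2 - g p.1) / d| ≤ 2 * M / δ := fun {d} hd => by
    rw [abs_div]
    have := (abs_sub (g p.2) (g p.1)).trans (add_le_add (hM _) (hM _))
    gcongr
    linarith
  by_cases h1 : p.1 ∈ Icc α β
  · have h1' : p.1 ∈ Ioo a b := ⟨ha.trans_le h1.1, h1.2.trans_lt hb⟩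
    have h2' : p.2 ∉ Ioo a b := fun h => hp ⟨h1', h, hp1, hp2⟩
    have hpB : p ∈ B := ⟨⟨by linarith [h1'.1], by linarith [h1'.2]⟩,
      ⟨by linarith [h1'.1], by linarith [h1'.2]⟩⟩
    rw [indicator_of_mem hpB]
    exact hle (hfar _ _ h1 h2')
  by_cases h2 : p.2 ∈ Icc α β
  · have h2' : p.2 ∈ Ioo a b := ⟨ha.trans_le h2.1, h2.2.trans_lt hb⟩
    have h1' : p.1 ∉ Ioo a b := fun h => hp ⟨h, h2', hp1, hp2⟩
    have hpB : p ∈ B := ⟨⟨by linarith [h2'.1], by linarith [h2'.2]⟩,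
      ⟨by linarith [h2'.1], by linarith [h2'.2]⟩⟩
    rw [indicator_of_mem hpB]
    exact hle (by rw [abs_sub_comm]; exact hfar _ _ h2 h1')
  · have e1 : g p.1 = 0 := by by_contra h; exact h1 (hsupp h)
    have e2 : g p.2 = 0 := by by_contra h; exact h2 (hsupp h)
    rw [diffQuot, e1, e2]
    simpa using h2p

lemma tendsto_eLpNorm_diagonal_translate_sub {G : ℝ × ℝ → ℝ} (hG : MemLp G 2 volume) :
    Tendsto (fun h : ℝ => eLpNorm (fun p => G p - G (p.1 - h, p.2 - h)) 2 volume)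
      (nhds 0) (nhds 0) := by
  have : VAddInvariantMeasure ℝ (ℝ × ℝ) volume := ⟨fun c s hs =>
    ((measurePreserving_add_left volume c).prod
      (measurePreserving_add_left volume c)).measure_preimage hs.nullMeasurableSet⟩
  have : Fact ((2 : ℝ≥0∞) ≠ ∞) := ⟨ENNReal.ofNat_ne_top⟩
  have hcont : Continuous fun h : ℝ => edist (hG.toLp G) (DomAddAct.mk (-h) +ᵥ hG.toLp G) := by
    have : Continuous fun h : ℝ => DomAddAct.mk (-h) :=
      DomAddAct.continuous_mk.comp continuous_neg
    fun_prop
  have := hcont.tendsto 0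
  simp only [neg_zero, DomAddAct.mk_zero, zero_vadd, edist_self] at this
  refine this.congr fun h => ?_
  rw [DomAddAct.mk_vadd_toLp, Lp.edist_toLp_toLp]
  congr 1
  ext p
  simp only [Pi.sub_apply]
  congr 2
  ext <;> simp <;> ring

lemma eLpNorm_two_integral_le {α β : Type*} [MeasurableSpace α] [MeasurableSpace β]
    {μ : Measure α} [SFinite μ] {π : Measure β} [IsProbabilityMeasure π] {Φ : α → β → ℝ}
    (hΦ : Measurable (Function.uncurry Φ)) {C : ℝ≥0∞}
    (hC : ∀ᵐ h ∂π, eLpNorm (fun p => Φ p h) 2 μ ≤ C) :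
    eLpNorm (fun p => ∫ h, Φ p h ∂π) 2 μ ≤ C := by
  have hC' : ∀ᵐ h ∂π, ∫⁻ p, ‖Φ p h‖ₑ ^ (2 : ℝ) ∂μ ≤ C ^ (2 : ℝ) := by
    filter_upwards [hC] with h hh
    rw [eLpNorm_eq_lintegral_rpow_enorm_toReal two_ne_zero ENNReal.ofNat_ne_top,
      ENNReal.toReal_ofNat, one_div, ENNReal.rpow_inv_le_iff two_pos] at hh
    exact hh
  have hjensen : ∀ p, ‖∫ h, Φ p h ∂π‖ₑ ^ (2 : ℝ) ≤ ∫⁻ h, ‖Φ p h‖ₑ ^ (2 : ℝ) ∂π := fun p => by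
    have hm : AEStronglyMeasurable (Φ p) π := (hΦ.comp measurable_prodMk_left).aestronglyMeasurable
    have h1 := (enorm_integral_le_lintegral_enorm (Φ p)).trans_eq
      (eLpNorm_one_eq_lintegral_enorm (μ := π)).symm |>.trans
      (eLpNorm_le_eLpNorm_of_exponent_le one_le_two hm)
    rwa [eLpNorm_eq_lintegral_rpow_enorm_toReal two_ne_zero ENNReal.ofNat_ne_top,
      ENNReal.toReal_ofNat, one_div, ENNReal.le_rpow_inv_iff two_pos] at h1
  rw [eLpNorm_eq_lintegral_rpow_enorm_toReal two_ne_zero ENNReal.ofNat_ne_top,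
    ENNReal.toReal_ofNat, one_div, ENNReal.rpow_inv_le_iff two_pos]
  calc _ ≤ ∫⁻ p, ∫⁻ h, ‖Φ p h‖ₑ ^ (2 : ℝ) ∂π ∂μ := lintegral_mono hjensen
    _ = ∫⁻ h, ∫⁻ p, ‖Φ p h‖ₑ ^ (2 : ℝ) ∂μ ∂π :=
        lintegral_lintegral_swap (hΦ.enorm.pow_const _).aemeasurable
    _ ≤ ∫⁻ _, C ^ (2 : ℝ) ∂π := lintegral_mono_ae hC'
    _ = C ^ (2 : ℝ) := by simp

open scoped Convolution in
lemma exists_smooth_approx {a b α β M : ℝ} {g : ℝ → ℝ} (hg : Measurable g) (ha : a < α)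
    (hb : β < b) (hsupp : Function.support g ⊆ Icc α β) (hM : ∀ x, |g x| ≤ M)
    (hint : Integrable g)
    (hE : MemLp (diffQuot g) 2 (volume.restrict (screenedSquare (Ioo a b))))
    {ε : ℝ} (hε : 0 < ε) :
    ∃ φ : ℝ → ℝ, ContDiff ℝ (⊤ : ℕ∞) φ ∧ HasCompactSupport φ ∧ tsupport φ ⊆ Ioo a b ∧
      eLpNorm (diffQuot fun x => g x - φ x) 2 (volume.restrict (screenedSquare (Ioo a b)))
        ≤ ENNReal.ofReal ε ∧ ∫ x, φ x = ∫ x, g x := by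
  have hG := memLp_stripQuot hg ha hb hsupp hM hE
  obtain ⟨δ, hδ0, hδ⟩ := Metric.eventually_nhds_iff.1
    ((tendsto_eLpNorm_diagonal_translate_sub hG).eventually_lt_const (ENNReal.ofReal_pos.2 hε))
  set r := min δ (min ((α - a) / 2) ((b - β) / 2)) with hr
  have hr0 : 0 < r := lt_min hδ0 (lt_min (by linarith) (by linarith))
  have hr1 : r ≤ δ := min_le_left _ _
  have hr2 : r ≤ (α - a) / 2 := (min_le_right _ _).trans (min_le_left _ _)
  have hr3 : r ≤ (b - β) / 2 := (min_le_right _ _).trans (min_le_right _ _)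
  let ψ : ContDiffBump (0 : ℝ) := ⟨r / 2, r, by positivity, by linarith⟩
  set ρ : ℝ → ℝ := ψ.normed volume with hρ
  have hρ0 : ∀ x, 0 ≤ ρ x := ψ.nonneg_normed
  have hρm : Measurable ρ := ψ.continuous_normed.measurable
  have hρint : Integrable ρ := ψ.integrable_normed
  have hρ1 : ∫ x, ρ x = 1 := ψ.integral_normed
  have hρs : Function.support ρ = Metric.ball 0 r := ψ.support_normed_eq
  set φ : ℝ → ℝ := ρ ⋆[ContinuousLinearMap.lsmul ℝ ℝ, volume] g with hφ
  have hφsupp : Function.support φ ⊆ Icc (α - r) (β + r) := by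
    refine (support_convolution_subset _).trans ?_
    rintro _ ⟨x, hx, y, hy, rfl⟩
    rw [hρs, mem_ball_zero_iff, Real.norm_eq_abs, abs_lt] at hx
    have := hsupp hy
    exact ⟨by simp only; linarith [this.1], by simp only; linarith [this.2]⟩
  set π : Measure ℝ := volume.withDensity fun x => ENNReal.ofReal (ρ x) with hπ
  have : IsProbabilityMeasure π := ⟨by
    rw [hπ, withDensity_apply _ MeasurableSet.univ, Measure.restrict_univ,
      ← ofReal_integral_eq_lintegral_ofReal hρint (ae_of_all _ hρ0), hρ1, ENNReal.ofReal_one]⟩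
  have hφπ : ∀ x, φ x = ∫ h, g (x - h) ∂π := fun x => by
    rw [hπ, integral_withDensity_eq_integral_toReal_smul (by fun_prop)
      (ae_of_all _ fun _ => ENNReal.ofReal_lt_top)]
    simp only [hφ, convolution_def, ContinuousLinearMap.lsmul_apply,
      ENNReal.toReal_ofReal (hρ0 _)]
  have hgπ : ∀ x, Integrable (fun h => g (x - h)) π := fun x =>
    (memLp_top_of_bound (hg.comp (measurable_id.const_sub x)).aestronglyMeasurable M
      (ae_of_all _ fun h => hM _)).integrable le_top
  have hkey : ∀ p ∈ screenedSquare (Ioo a b), diffQuot (fun x => g x - φ x) p =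
      ∫ h, (stripQuot g p - stripQuot g (p.1 - h, p.2 - h)) ∂π := fun p hp => by
    have hmem : ∀ h : ℝ, (p.1 - h, p.2 - h) ∈ screenedSquare univ := fun h => by
      obtain ⟨-, -, h1, h2⟩ := hp
      exact ⟨mem_univ _, mem_univ _, by simp only; linarith, by simp only; linarith⟩
    have h1 : ∀ h : ℝ, stripQuot g (p.1 - h, p.2 - h) =
        (g (p.2 - h) - g (p.1 - h)) / (p.2 - p.1) := fun h => by
      rw [stripQuot, indicator_of_mem (hmem h), diffQuot]
      simp
    have h0 : stripQuot g p = (g p.2 - g p.1) / (p.2 - p.1) := by simpa using h1 0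
    simp only [h1, h0]
    have hd : Integrable (fun h => (g (p.2 - h) - g (p.1 - h)) / (p.2 - p.1)) π :=
      ((hgπ _).sub (hgπ _)).div_const _
    rw [integral_sub (integrable_const _) hd, integral_const,
      integral_div, integral_sub (hgπ _) (hgπ _), ← hφπ, ← hφπ, diffQuot]
    simp
    ring
  have hπr : ∀ᵐ h ∂π, dist h 0 < δ := by
    rw [hπ, ae_withDensity_iff (by fun_prop)]
    refine ae_of_all _ fun h hh => ?_
    have : h ∈ Function.support ρ := fun h0 => hh (by simp [h0])
    rw [hρs] at this
    exact (Metric.mem_ball.1 this).trans_le hr1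
  refine ⟨φ, ψ.hasCompactSupport_normed.contDiff_convolution_left _ ψ.contDiff_normed
    hint.locallyIntegrable, HasCompactSupport.of_support_subset_isCompact isCompact_Icc hφsupp,
    (closure_minimal hφsupp isClosed_Icc).trans (Icc_subset_Ioo (by linarith) (by linarith)),
    ?_, ?_⟩
  · rw [eLpNorm_congr_ae ((ae_restrict_mem
      (measurableSet_screenedSquare measurableSet_Ioo)).mono hkey)]
    refine eLpNorm_two_integral_le ?_ (hπr.mono fun h hh => ?_)
    · have := hg.stripQuot
      simp only [Function.uncurry_def]
      fun_prop
    · exact (eLpNorm_mono_measure _ Measure.restrict_le_self).trans (hδ hh).le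
  · rw [hφ, integral_convolution _ hρint hint, hρ1]
    simp

/-- density of `C_c^∞(I)` in `Ḣ^{1/2}(I)` on a nonempty bounded open
interval `I = (a, b)`, with approximate matching of averages: for every `f ∈ L¹(I)` with
`|f|_{Ḣ^{1/2}(I)} < ∞` and every `ε > 0` there is a smooth `φ` compactly supported in `I`
with `|f − φ|_{Ḣ^{1/2}(I)} < ε` and `|avg_I (f − φ)| < ε`. -/
theorem statement16 (a b : ℝ) (hab : a < b) (f : ℝ → ℝ)
    (hf : IntegrableOn f (Set.Ioo a b))
    (hfin : screenedSeminorm (Set.Ioo a b) 1 f < ⊤) (ε : ℝ) (hε : 0 < ε) :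
    ∃ φ : ℝ → ℝ, ContDiff ℝ (⊤ : ℕ∞) φ ∧ HasCompactSupport φ ∧
      tsupport φ ⊆ Set.Ioo a b ∧
      screenedSeminorm (Set.Ioo a b) 1 (fun x => f x - φ x) < ENNReal.ofReal ε ∧
      |avgOn (Set.Ioo a b) (fun x => f x - φ x)| < ε := by
  have hI : MeasurableSet (Ioo a b) := measurableSet_Ioo
  set f₀ : ℝ → ℝ := (Ioo a b).indicator (hf.1.mk f) with hf₀
  have hf₀m : Measurable f₀ := hf.1.stronglyMeasurable_mk.measurable.indicator hI
  have hff₀ : f =ᵐ[volume.restrict (Ioo a b)] f₀ := by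
    filter_upwards [hf.1.ae_eq_mk, ae_restrict_mem hI] with x hx hxI
    rw [hx, hf₀, indicator_of_mem hxI]
  have hf₀int : Integrable f₀ := by
    rw [hf₀, integrable_indicator_iff hI]
    exact hf.congr hf.1.ae_eq_mk
  have hf₀E : MemLp (diffQuot f₀) 2 (volume.restrict (screenedSquare (Ioo a b))) := by
    refine ⟨hf₀m.diffQuot.aestronglyMeasurable, ?_⟩
    rwa [← screenedSeminorm_eq_eLpNorm_s16 hI hf₀m, ← screenedSeminorm_congr_ae hff₀]
  have hL : 0 < b - a := sub_pos.2 hab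
  set η := min (ε / 4) (ε * (b - a) / 4) with hη
  have hη0 : 0 < η := lt_min (by positivity) (by positivity)
  have hη1 : η ≤ ε / 4 := min_le_left _ _
  have hη2 : η ≤ ε * (b - a) / 4 := min_le_right _ _
  obtain ⟨g, hgm, hgs, hgint, hgE, ⟨M, hM⟩, hfg, hfg'⟩ :=
    exists_bounded_approx hf₀m support_indicator_subset hf₀int hf₀E hη0
  obtain ⟨k, hkm, ⟨α, β, ha, hb, hks⟩, hkint, hkE, hkM, hgk, hgk'⟩ :=
    exists_compactSupport_approx hab hgm hgs hgint hgE hM hη0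
  obtain ⟨φ, hφ, hφc, hφs, hkφ, hkφ'⟩ := exists_smooth_approx hkm ha hb hks hkM hkint hkE hη0
  have hφm : Measurable φ := hφ.continuous.measurable
  have hφint : Integrable φ := hφ.continuous.integrable_of_hasCompactSupport hφc
  have hfφ : (fun x => f x - φ x) =ᵐ[volume.restrict (Ioo a b)] fun x => f₀ x - φ x := by
    filter_upwards [hff₀] with x hx
    rw [hx]
  refine ⟨φ, hφ, hφc, hφs, ?_, ?_⟩
  · rw [screenedSeminorm_congr_ae hfφ,
      screenedSeminorm_eq_eLpNorm_s16 (f := fun x => f₀ x - φ x) hI (hf₀m.sub hφm)]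
    have hsum : diffQuot (fun x => f₀ x - φ x) = diffQuot (fun x => f₀ x - g x) +
        (diffQuot (fun x => g x - k x) + diffQuot fun x => k x - φ x) := by
      simp only [diffQuot_sub]
      ring
    have h1 : Measurable (diffQuot fun x => f₀ x - g x) := (hf₀m.sub hgm).diffQuot
    have h2 : Measurable (diffQuot fun x => g x - k x) := (hgm.sub hkm).diffQuot
    have h3 : Measurable (diffQuot fun x => k x - φ x) := (hkm.sub hφm).diffQuot
    have hle : eLpNorm (diffQuot fun x => f₀ x - φ x) 2
        (volume.restrict (screenedSquare (Ioo a b))) ≤ ENNReal.ofReal (η + (η + η)) := by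
      rw [hsum, ENNReal.ofReal_add hη0.le (by positivity), ENNReal.ofReal_add hη0.le hη0.le]
      refine (eLpNorm_add_le h1.aestronglyMeasurable (h2.add h3).aestronglyMeasurable
        one_le_two).trans (add_le_add hfg.le ?_)
      exact (eLpNorm_add_le h2.aestronglyMeasurable h3.aestronglyMeasurable
        one_le_two).trans (add_le_add hgk.le hkφ)
    exact hle.trans_lt ((ENNReal.ofReal_lt_ofReal_iff hε).2 (by linarith))
  · have hint : ∫ x in Ioo a b, (f x - φ x) = (∫ x, (f₀ x - g x)) + ∫ x, (g x - k x) := by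
      rw [integral_congr_ae hfφ, setIntegral_eq_integral_of_forall_compl_eq_zero fun x hx => ?_,
        integral_sub hf₀int hφint, integral_sub hf₀int hgint, integral_sub hgint hkint, hkφ']
      · ring
      · rw [hf₀, indicator_of_notMem hx, image_eq_zero_of_notMem_tsupport fun h => hx (hφs h),
          sub_zero]
    rw [avgOn, hint, Real.volume_Ioo, ENNReal.toReal_ofReal hL.le, abs_mul,
      abs_of_pos (inv_pos.2 hL), inv_mul_lt_iff₀ hL]
    have : 0 < ε * (b - a) := by positivity
    linarith [abs_add_le (∫ x, (f₀ x - g x)) (∫ x, (g x - k x))]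
end
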